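/- arXiv:2601.21719 — 4 statements merged into one kernel-verified Lean document; each statement's English description precedes it below -/
import Mathlib

section
/- Let d > r ≥ 1 be integers and let Z ∈ ℝ^{d×r} have i.i.d. N(0, 1/r) entries; set M = Z Zᵀ. Let v, v′ ∈ ℝ^d be unit vectors with ρ := ⟨v, v′⟩ ∈ (0, 1). Fix δ′ ∈ (0,1), let q := t_r(1 − δ′/3) be the (1 − δ′/3)-quantile of the Student-t distribution with r degrees of freedom, set a₋ := ρ − √((1−ρ²)/r)·q, a₊ := ρ + √((1−ρ²)/r)·q, and let b := κ_{d+r−1}(1 − δ′/3) be the (1 − δ′/3)-quantile of the chi-square distribution with d+r−1 degrees of freedom; assume a₋ > 0. Define ε_ρ := ((d−r+1)/2)·ln(a₊) + (b/2)·(1/a₋ − 1) and δ_supp := E_{X∼χ²_r}[Φ(−ρ√X / √(1−ρ²))], where Φ is the standard normal CDF. Then for every Borel set A ⊆ ℝ^d, ℙ(Mv ∈ A) ≤ e^{ε_ρ}·ℙ(Mv′ ∈ A) + δ′ + δ_supp. -/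
open MeasureTheory ProbabilityTheory Matrix

/-- Chi-square distribution with `k` degrees of freedom: the law of the sum of squares of
`k` i.i.d. standard Gaussians. -/
noncomputable def chiSq (k : ℕ) : Measure ℝ :=
  Measure.map (fun x : Fin k → ℝ => ∑ i, (x i) ^ 2) (Measure.pi fun _ => gaussianReal 0 1)

/-- Standard normal CDF. -/
noncomputable def Phi (x : ℝ) : ℝ := ((gaussianReal 0 1) (Set.Iic x)).toReal

/-- Student-t distribution with `r` degrees of freedom: the law of `Z₀ / √(V/r)` for
independent `Z₀ ∼ N(0,1)` and `V ∼ χ²_r`. -/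
noncomputable def studentT (r : ℕ) : Measure ℝ :=
  Measure.map (fun p : ℝ × ℝ => p.1 / Real.sqrt (p.2 / r)) ((gaussianReal 0 1).prod (chiSq r))

/-- The `p`-quantile of a real distribution. -/
noncomputable def quantile (μ : Measure ℝ) (p : ℝ) : ℝ :=
  sInf {x : ℝ | p ≤ (μ (Set.Iic x)).toReal}

/-- The law of independent standard Gaussians indexed by `ι`. -/
noncomputable abbrev gaussPi (ι : Type*) [Fintype ι] : Measure (ι → ℝ) :=
  Measure.pi fun _ => gaussianReal 0 1

lemma gaussPi_eq_withDensity (ι : Type*) [Fintype ι] :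
    gaussPi ι = volume.withDensity fun x =>
      ENNReal.ofReal ((√(2 * Real.pi))⁻¹ ^ Fintype.card ι * Real.exp (-(∑ i, x i ^ 2) / 2)) := by
  have hg : ∀ x : ι → ℝ,
      (√(2 * Real.pi))⁻¹ ^ Fintype.card ι * Real.exp (-(∑ i, x i ^ 2) / 2)
        = ∏ i, gaussianPDFReal 0 1 (x i) := by
    intro x
    simp [gaussianPDFReal, Finset.prod_mul_distrib, ← Real.exp_sum, neg_div, Finset.sum_div]
  simp_rw [hg]
  refine Measure.pi_eq fun s hs => ?_
  have hint : Integrable (fun x : ι → ℝ => ∏ i, gaussianPDFReal 0 1 (x i)) :=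
    Integrable.fintype_prod fun _ => integrable_gaussianPDFReal 0 1
  rw [withDensity_apply _ (MeasurableSet.univ_pi hs),
    ← ofReal_integral_eq_lintegral_ofReal hint.restrict
      (ae_of_all _ fun x => Finset.prod_nonneg fun i _ => gaussianPDFReal_nonneg 0 1 (x i)),
    volume_pi, Measure.restrict_pi_pi,
    integral_fintype_prod_eq_prod (f := fun _ x => gaussianPDFReal 0 1 x),
    ENNReal.ofReal_prod_of_nonneg
      (fun i _ => integral_nonneg fun x => gaussianPDFReal_nonneg 0 1 x)]
  simp [gaussianReal_apply_eq_integral]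

lemma map_sum_mul_gaussPi {ι : Type*} [Fintype ι] (a : ι → ℝ) :
    (gaussPi ι).map (fun x => ∑ i, a i * x i)
      = gaussianReal 0 (∑ i, a i ^ 2).toNNReal := by
  have h := IsGaussian.map_eq_gaussianReal (μ := stdGaussian (EuclideanSpace ℝ ι))
    (innerSL ℝ (WithLp.toLp 2 a))
  rw [integral_strongDual_stdGaussian, variance_dual_stdGaussian, innerSL_apply_norm,
    EuclideanSpace.real_norm_sq_eq, ← map_pi_eq_stdGaussian, Measure.map_map (by fun_prop)
    (by fun_prop)] at h
  rw [← h]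
  congr 1
  ext x
  simp [PiLp.inner_apply, mul_comm]

lemma map_smul_gaussianReal (c : ℝ) :
    (gaussianReal 0 1).map (fun x => c * x) = gaussianReal 0 (c ^ 2).toNNReal := by
  rw [gaussianReal_map_const_mul]
  congr 1
  · simp
  · ext; simp [sq_nonneg]

lemma map_swap_pi_pi {ι κ X : Type*} [Fintype ι] [Fintype κ] [MeasurableSpace X] (μ : Measure X)
    [IsProbabilityMeasure μ] :
    (Measure.pi fun _ : ι => Measure.pi fun _ : κ => μ).map Function.swap
      = Measure.pi fun _ : κ => Measure.pi fun _ : ι => μ := by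
  have h1 := Measure.infinitePi_map_curry_symm (fun (_ : ι) (_ : κ) => μ)
  have h2 := Measure.infinitePi_map_curry (fun (_ : κ) (_ : ι) => μ)
  have h3 := (measurePreserving_piCongrLeft (fun _ : κ × ι => μ) (Equiv.prodComm ι κ)).map_eq
  simp only [Measure.infinitePi_eq_pi] at h1 h2
  rw [← h2, ← h3, ← h1, Measure.map_map (by fun_prop) (by fun_prop),
    Measure.map_map (by fun_prop) (by fun_prop)]
  congr 1

lemma gaussPi_map_linearIsometryEquiv {ι : Type*} [Fintype ι]
    (U : EuclideanSpace ℝ ι ≃ₗᵢ[ℝ] EuclideanSpace ℝ ι) :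
    (gaussPi ι).map (fun x => (U (WithLp.toLp 2 x)).ofLp) = gaussPi ι := by
  have h := stdGaussian_map U
  rw [← map_pi_eq_stdGaussian] at h
  have h' := congrArg (Measure.map (WithLp.ofLp)) h
  rw [Measure.map_map (by fun_prop) (by fun_prop), Measure.map_map (by fun_prop) (by fun_prop),
    Measure.map_map (by fun_prop) (by fun_prop)] at h'
  have e : (WithLp.ofLp ∘ WithLp.toLp 2 : (ι → ℝ) → (ι → ℝ)) = id := rfl
  rw [e, Measure.map_id] at h'
  exact h'

lemma volume_map_linearIsometryEquiv {ι : Type*} [Fintype ι]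
    (U : EuclideanSpace ℝ ι ≃ₗᵢ[ℝ] EuclideanSpace ℝ ι) :
    MeasurePreserving (fun x : ι → ℝ => (U (WithLp.toLp 2 x)).ofLp) :=
  (PiLp.volume_preserving_ofLp ι).comp (U.measurePreserving.comp (PiLp.volume_preserving_toLp ι))

lemma lintegral_fun_norm {E : Type*} [NormedAddCommGroup E] [NormedSpace ℝ E]
    [FiniteDimensional ℝ E] [Nontrivial E] [MeasurableSpace E] [BorelSpace E] (μ : Measure E)
    [μ.IsAddHaarMeasure] {f : ℝ → ENNReal} (hf : Measurable f) :
    ∫⁻ x, f ‖x‖ ∂μ = μ.toSphere Set.univ *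
      ∫⁻ y in Set.Ioi (0 : ℝ), ENNReal.ofReal (y ^ (Module.finrank ℝ E - 1)) * f y := by
  calc ∫⁻ x, f ‖x‖ ∂μ = ∫⁻ x in ({0}ᶜ : Set E), f ‖x‖ ∂μ := by
        rw [restrict_compl_singleton]
    _ = ∫⁻ x : ({0}ᶜ : Set E), f ‖x.1‖ ∂(μ.comap (↑)) := by
        rw [lintegral_subtype_comap (measurableSet_singleton _).compl fun x => f ‖x‖]
    _ = ∫⁻ x : Metric.sphere (0 : E) 1 × Set.Ioi (0 : ℝ), f x.2
          ∂μ.toSphere.prod (.volumeIoiPow (Module.finrank ℝ E - 1)) := by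
        rw [← μ.measurePreserving_homeomorphUnitSphereProd.lintegral_comp (by fun_prop)]
        simp [homeomorphUnitSphereProd]
    _ = μ.toSphere Set.univ *
          ∫⁻ x : Set.Ioi (0 : ℝ), f x ∂(.volumeIoiPow (Module.finrank ℝ E - 1)) := by
        rw [lintegral_prod _ (by fun_prop)]
        simp [mul_comm]
    _ = _ := by
        congr 1
        rw [Measure.volumeIoiPow, lintegral_withDensity_eq_lintegral_mul _ (by fun_prop)
          (by fun_prop)]
        exact lintegral_subtype_comap measurableSet_Ioi
          (fun y : ℝ => ENNReal.ofReal (y ^ (Module.finrank ℝ E - 1)) * f y)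

lemma lintegral_comp_sq_Ioi (f : ℝ → ENNReal) :
    ∫⁻ s in Set.Ioi (0 : ℝ), f s
      = ∫⁻ t in Set.Ioi (0 : ℝ), ENNReal.ofReal (2 * t) * f (t ^ 2) := by
  have him : (fun t : ℝ => t ^ 2) '' Set.Ioi 0 = Set.Ioi 0 := by
    ext s
    constructor
    · rintro ⟨t, ht, rfl⟩
      exact pow_pos (Set.mem_Ioi.1 ht) 2
    · intro hs
      exact ⟨√s, Real.sqrt_pos.2 hs, Real.sq_sqrt (le_of_lt hs)⟩
  conv_lhs => rw [← him]
  rw [lintegral_image_eq_lintegral_abs_deriv_mul measurableSet_Ioi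
    (f' := fun t => 2 * t)
    (fun t _ => by simpa using (hasDerivAt_pow 2 t).hasDerivWithinAt)
    (fun a ha b hb hab => by
      simpa [abs_of_pos (Set.mem_Ioi.1 ha), abs_of_pos (Set.mem_Ioi.1 hb)] using
        (sq_eq_sq_iff_abs_eq_abs a b).1 hab)]
  refine setLIntegral_congr_fun measurableSet_Ioi fun t ht => ?_
  rw [abs_of_pos (mul_pos two_pos ht)]

lemma lintegral_sum_sq_gaussPi (r : ℕ) (hr : 1 ≤ r) :
    ∃ C : ENNReal, ∀ f : ℝ → ENNReal, Measurable f →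
      ∫⁻ x, f (∑ i, x i ^ 2) ∂gaussPi (Fin r)
        = C * ∫⁻ s in Set.Ioi (0 : ℝ),
            ENNReal.ofReal (s ^ ((r : ℝ) / 2 - 1) * Real.exp (-s / 2)) * f s := by
  set c : ℝ := (√(2 * Real.pi))⁻¹ ^ r
  have hc : 0 ≤ c := by positivity
  have : Nontrivial (EuclideanSpace ℝ (Fin r)) := by
    have : Nonempty (Fin r) := ⟨⟨0, hr⟩⟩
    infer_instance
  set S := (volume : Measure (EuclideanSpace ℝ (Fin r))).toSphere Set.univ
  refine ⟨S * ENNReal.ofReal c * ENNReal.ofReal (1 / 2), fun f hf => ?_⟩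
  set g : ℝ → ENNReal := fun t => ENNReal.ofReal (c * Real.exp (-t ^ 2 / 2)) * f (t ^ 2) with hg
  have hgm : Measurable g := by fun_prop
  have h1 : ∫⁻ x, f (∑ i, x i ^ 2) ∂gaussPi (Fin r)
      = ∫⁻ x : EuclideanSpace ℝ (Fin r), g ‖x‖ := by
    rw [gaussPi_eq_withDensity, lintegral_withDensity_eq_lintegral_mul _ (by fun_prop)
      (by fun_prop), ← (PiLp.volume_preserving_ofLp (Fin r)).lintegral_comp (by fun_prop)]
    refine lintegral_congr fun x => ?_
    simp only [hg, Pi.mul_apply, Fintype.card_fin, EuclideanSpace.real_norm_sq_eq, c]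
  rw [h1, lintegral_fun_norm _ hgm, lintegral_comp_sq_Ioi (fun s => ENNReal.ofReal (_) * f s), mul_assoc, mul_assoc,
    ← lintegral_const_mul' _ _ ENNReal.ofReal_ne_top,
    ← lintegral_const_mul' _ _ ENNReal.ofReal_ne_top]
  congr 1
  refine setLIntegral_congr_fun measurableSet_Ioi fun t ht => ?_
  have ht : 0 < t := ht
  simp only [hg, ← mul_assoc]
  congr 1
  rw [← ENNReal.ofReal_mul (by positivity), ← ENNReal.ofReal_mul (by positivity),
    ← ENNReal.ofReal_mul (by positivity), ← ENNReal.ofReal_mul (by positivity)]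
  congr 1
  have h2 : (t ^ 2) ^ ((r : ℝ) / 2 - 1) * t = t ^ (r - 1) := by
    rw [← Real.rpow_natCast t 2, ← Real.rpow_mul ht.le, ← Real.rpow_add_one ht.ne',
      ← Real.rpow_natCast, Nat.cast_sub hr]
    congr 1
    push_cast
    ring
  rw [finrank_euclideanSpace_fin, ← h2]
  ring

lemma lintegral_comp_sqrt_smul_gaussPi (m : ℕ) {f : (Fin m → ℝ) → ENNReal} (hf : Measurable f)
    {s : ℝ} (hs : 0 < s) :
    ∫⁻ x, f (√s • x) ∂gaussPi (Fin m)
      = ENNReal.ofReal ((√(2 * Real.pi))⁻¹ ^ m) * ∫⁻ x,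
          ENNReal.ofReal (s ^ (-(m : ℝ) / 2) * Real.exp (-(∑ i, x i ^ 2) / (2 * s))) * f x := by
  have hs' : √s ≠ 0 := (Real.sqrt_pos.2 hs).ne'
  set h : (Fin m → ℝ) → ENNReal := fun x =>
    ENNReal.ofReal ((√(2 * Real.pi))⁻¹ ^ m * Real.exp (-(∑ i, x i ^ 2) / (2 * s))) * f x with hh
  have hm : Measurable h := by fun_prop
  have h1 : ∫⁻ x, f (√s • x) ∂gaussPi (Fin m) = ∫⁻ x, h (√s • x) := by
    rw [gaussPi_eq_withDensity, lintegral_withDensity_eq_lintegral_mul _ (by fun_prop)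
      (by fun_prop)]
    refine lintegral_congr fun x => ?_
    simp only [hh, Pi.mul_apply, Fintype.card_fin, Pi.smul_apply, smul_eq_mul, mul_pow,
      Real.sq_sqrt hs.le, ← Finset.mul_sum]
    congr 3
    field_simp
  rw [h1, ← lintegral_map (f := h) (g := fun x => √s • x) hm (by fun_prop),
    Measure.map_addHaar_smul _ hs', lintegral_smul_measure,
    ← lintegral_const_mul' _ _ ENNReal.ofReal_ne_top, smul_eq_mul,
    ← lintegral_const_mul' _ _ ENNReal.ofReal_ne_top]
  refine lintegral_congr fun x => ?_
  simp only [hh, ← mul_assoc]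
  congr 1
  rw [← ENNReal.ofReal_mul (by positivity), ← ENNReal.ofReal_mul (by positivity)]
  congr 1
  have : |((√s) ^ Module.finrank ℝ (Fin m → ℝ))⁻¹| = s ^ (-(m : ℝ) / 2) := by
    rw [abs_of_nonneg (by positivity), Module.finrank_fin_fun, Real.sqrt_eq_rpow,
      ← Real.rpow_natCast, ← Real.rpow_mul hs.le, ← Real.rpow_neg hs.le]
    congr 1
    ring
  rw [this]
  ring

/-- Up to normalization, the density of `W Wᵀ v` at `y`, as a function of `s = ⟨v, y⟩` and
`t = ‖y‖²`; here `W` is an `(m + 1) × r` standard Gaussian matrix and `v` a unit vector. -/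
noncomputable def wishartKernel (m r : ℕ) (s t : ℝ) : ENNReal :=
  (Set.Ioi (0 : ℝ)).indicator
    (fun s => ENNReal.ofReal (s ^ (-((m : ℝ) + 2 - r) / 2) * Real.exp (-t / (2 * s)))) s

lemma measurable_wishartKernel (m r : ℕ) :
    Measurable fun p : ℝ × ℝ => wishartKernel m r p.1 p.2 := by
  have : (fun p : ℝ × ℝ => wishartKernel m r p.1 p.2)
      = (Prod.fst ⁻¹' Set.Ioi (0 : ℝ)).indicator (fun p => ENNReal.ofReal
          (p.1 ^ (-((m : ℝ) + 2 - r) / 2) * Real.exp (-p.2 / (2 * p.1)))) := by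
    ext p
    rfl
  rw [this]
  exact Measurable.indicator (by fun_prop) (measurable_fst measurableSet_Ioi)

/-- The first column of `W Wᵀ`, as a function of the first row `g` of `W` and the normalized
scalar products of `g` with the other rows. -/
noncomputable def wishartColumn {m r : ℕ} (g : Fin r → ℝ) (n : Fin m → ℝ) : Fin (m + 1) → ℝ :=
  Fin.cons (∑ i, g i ^ 2) (√(∑ i, g i ^ 2) • n)

lemma measurable_finCons (m : ℕ) :
    Measurable fun p : ℝ × (Fin m → ℝ) => (Fin.cons p.1 p.2 : Fin (m + 1) → ℝ) := by
  refine measurable_pi_iff.2 fun i => ?_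
  refine Fin.cases ?_ (fun j => ?_) i
  · simpa using measurable_fst
  · simp only [Fin.cons_succ]
    fun_prop

lemma measurable_wishartColumn (m r : ℕ) :
    Measurable fun p : (Fin r → ℝ) × (Fin m → ℝ) => wishartColumn p.1 p.2 :=
  (measurable_finCons m).comp
    (f := fun p : (Fin r → ℝ) × (Fin m → ℝ) => (∑ i, p.1 i ^ 2, √(∑ i, p.1 i ^ 2) • p.2))
    (by fun_prop)

lemma lintegral_wishartColumn_eq_volume (m r : ℕ) (hr : 1 ≤ r) :
    ∃ C : ENNReal, ∀ f : (Fin (m + 1) → ℝ) → ENNReal, Measurable f →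
      ∫⁻ g, ∫⁻ n, f (wishartColumn g n) ∂gaussPi (Fin m) ∂gaussPi (Fin r)
        = C * ∫⁻ y, wishartKernel m r (y 0) (∑ i, y i ^ 2) * f y := by
  obtain ⟨C, hC⟩ := lintegral_sum_sq_gaussPi r hr
  set c := ENNReal.ofReal ((√(2 * Real.pi))⁻¹ ^ m)
  refine ⟨C * c, fun f hf => ?_⟩
  have hfc := hf.comp (measurable_finCons m)
  have hcons (s : ℝ) : Measurable fun n : Fin m → ℝ => f (Fin.cons s n) :=
    hfc.comp (measurable_prodMk_left (x := s))
  have hcons' : Measurable fun p : ℝ × (Fin m → ℝ) => f (Fin.cons p.1 (√p.1 • p.2)) :=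
    hfc.comp (g := fun p : ℝ × (Fin m → ℝ) => f (Fin.cons p.1 p.2))
      (f := fun p : ℝ × (Fin m → ℝ) => (p.1, √p.1 • p.2)) (by fun_prop)
  have h1 := hC (fun s => ∫⁻ n, f (Fin.cons s (√s • n)) ∂gaussPi (Fin m))
    hcons'.lintegral_prod_right'
  have hK : Measurable fun y : Fin (m + 1) → ℝ =>
      wishartKernel m r (y 0) (∑ i, y i ^ 2) * f y :=
    ((measurable_wishartKernel m r).comp
      (f := fun y : Fin (m + 1) → ℝ => (y 0, ∑ i, y i ^ 2)) (by fun_prop)).mul hf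
  have hvol := (volume_preserving_piFinSuccAbove (fun _ : Fin (m + 1) => ℝ) 0).symm
  have h2 : ∫⁻ y, wishartKernel m r (y 0) (∑ i, y i ^ 2) * f y
      = ∫⁻ s, ∫⁻ n : Fin m → ℝ,
          wishartKernel m r s (s ^ 2 + ∑ i, n i ^ 2) * f (Fin.cons s n) := by
    rw [← hvol.lintegral_comp hK, Measure.volume_eq_prod, lintegral_prod]
    · refine lintegral_congr fun s => lintegral_congr fun n => ?_
      simp [MeasurableEquiv.piFinSuccAbove, Fin.sum_univ_succ]
      rfl
    · exact (hK.comp (MeasurableEquiv.measurable _)).aemeasurable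
  simp only [wishartColumn]
  rw [h1, h2, mul_assoc, ← lintegral_const_mul' c _ ENNReal.ofReal_ne_top,
    ← lintegral_indicator measurableSet_Ioi]
  congr 1
  refine lintegral_congr fun s => ?_
  by_cases hs : 0 < s
  swap
  · simp [hs, wishartKernel]
  simp only [wishartKernel, Set.indicator, Set.mem_Ioi, hs, if_true]
  rw [lintegral_comp_sqrt_smul_gaussPi m (hcons s) hs, mul_left_comm,
    ← lintegral_const_mul' _ _ ENNReal.ofReal_ne_top]
  congr 1
  refine lintegral_congr fun n => ?_
  rw [← mul_assoc, ← ENNReal.ofReal_mul (by positivity)]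
  congr 2
  rw [mul_mul_mul_comm, ← Real.rpow_add hs, ← Real.exp_add]
  congr 2
  · ring
  · field_simp
    ring

lemma lintegral_mul_transpose_mulVec (m r : ℕ)
    (U : EuclideanSpace ℝ (Fin (m + 1)) ≃ₗᵢ[ℝ] EuclideanSpace ℝ (Fin (m + 1)))
    (v : Fin (m + 1) → ℝ) (hU : U (EuclideanSpace.single 0 1) = WithLp.toLp 2 v)
    {f : (Fin (m + 1) → ℝ) → ENNReal} (hf : Measurable f) :
    ∫⁻ W, f ((Matrix.of W * (Matrix.of W)ᵀ) *ᵥ v)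
        ∂(Measure.pi fun _ : Fin (m + 1) => gaussPi (Fin r))
      = ∫⁻ g, ∫⁻ n, f (U (WithLp.toLp 2 (wishartColumn g n))).ofLp
          ∂gaussPi (Fin m) ∂gaussPi (Fin r) := by
  set R : (Fin (m + 1) → ℝ) → (Fin (m + 1) → ℝ) := fun x => (U (WithLp.toLp 2 x)).ofLp with hR
  have hRm : Measurable R := by fun_prop
  have hrot : (Measure.pi fun _ : Fin (m + 1) => gaussPi (Fin r)).map
      (fun W => Function.swap fun k => R (Function.swap W k))
      = Measure.pi fun _ : Fin (m + 1) => gaussPi (Fin r) := by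
    have h1 := map_swap_pi_pi (ι := Fin (m + 1)) (κ := Fin r) (gaussianReal 0 1)
    have h2 := map_swap_pi_pi (κ := Fin (m + 1)) (ι := Fin r) (gaussianReal 0 1)
    have h3 : (Measure.pi fun _ : Fin r => gaussPi (Fin (m + 1))).map (fun W k => R (W k))
        = Measure.pi fun _ : Fin r => gaussPi (Fin (m + 1)) := by
      rw [Measure.pi_map_pi (fun _ => hRm.aemeasurable)]
      simp only [hR, gaussPi_map_linearIsometryEquiv]
    rw [← h2]
    conv_rhs => rw [← h3, ← h1]
    rw [h2, Measure.map_map (by fun_prop) (by fun_prop), Measure.map_map (by fun_prop)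
      (by fun_prop)]
    rfl
  have hcol : ∀ X : Fin (m + 1) → Fin r → ℝ,
      (Matrix.of (Function.swap fun k => R (Function.swap X k))
        * (Matrix.of (Function.swap fun k => R (Function.swap X k)))ᵀ) *ᵥ v
        = R (fun i => ∑ k, X 0 k * X i k) := by
    intro X
    have hv (k : Fin r) : R (Function.swap X k) ⬝ᵥ v = X 0 k := by
      have h := U.inner_map_map (WithLp.toLp 2 (Function.swap X k)) (EuclideanSpace.single 0 1)
      rw [hU] at h
      simpa [EuclideanSpace.inner_eq_star_dotProduct, dotProduct_comm, Function.swap] using h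
    have hlin : R (fun i => ∑ k, X 0 k * X i k) = ∑ k, X 0 k • R (Function.swap X k) := by
      have : WithLp.toLp 2 (fun i => ∑ k, X 0 k * X i k)
          = ∑ k, X 0 k • WithLp.toLp 2 (Function.swap X k) := by
        ext i
        simp [Function.swap]
      simp [hR, this]
    rw [hlin, ← mulVec_mulVec]
    ext i
    rw [Finset.sum_apply, mulVec, dotProduct]
    refine Finset.sum_congr rfl fun k _ => ?_
    rw [show ((Matrix.of (Function.swap fun k => R (Function.swap X k)))ᵀ *ᵥ v) k = X 0 k from
      hv k, mul_comm]
    rfl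
  have hm : Measurable fun W : Fin (m + 1) → Fin r → ℝ =>
      f ((Matrix.of W * (Matrix.of W)ᵀ) *ᵥ v) := by
    refine hf.comp (measurable_pi_iff.2 fun i => ?_)
    simp only [mulVec, dotProduct, mul_apply, of_apply, transpose_apply]
    fun_prop
  rw [← hrot, lintegral_map hm (by fun_prop)]
  simp_rw [hcol]
  have hm2 : Measurable fun X : Fin (m + 1) → Fin r → ℝ => f (R fun i => ∑ k, X 0 k * X i k) :=
    hf.comp (hRm.comp (by fun_prop))
  have hsplit :=
    (measurePreserving_piFinSuccAbove (fun _ : Fin (m + 1) => gaussPi (Fin r)) 0).symm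
  rw [← hsplit.lintegral_comp hm2]
  refine (lintegral_prod _ (hm2.comp (MeasurableEquiv.measurable _)).aemeasurable).trans ?_
  refine lintegral_congr fun g => ?_
  have hrow : (Measure.pi fun _ : Fin m => gaussPi (Fin r)).map
      (fun Y i => ∑ k, g k * Y i k) = (gaussPi (Fin m)).map (√(∑ k, g k ^ 2) • ·) := by
    rw [Measure.pi_map_pi (f := fun _ (y : Fin r → ℝ) => ∑ k, g k * y k)
      (fun _ => Measurable.aemeasurable (by fun_prop))]
    simp only [map_sum_mul_gaussPi]
    have : (fun n : Fin m → ℝ => √(∑ k, g k ^ 2) • n)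
        = fun n i => (fun x => √(∑ k, g k ^ 2) * x) (n i) := rfl
    rw [this, Measure.pi_map_pi (f := fun _ (x : ℝ) => √(∑ k, g k ^ 2) * x) (fun _ => by fun_prop)]
    simp only [map_smul_gaussianReal]
    rw [Real.sq_sqrt (Finset.sum_nonneg fun _ _ => sq_nonneg _)]
  have hm3 : Measurable fun n : Fin m → ℝ => f (R (Fin.cons (∑ k, g k ^ 2) n)) :=
    hf.comp (hRm.comp ((measurable_finCons m).comp measurable_prodMk_left))
  have h := congrArg (fun μ => ∫⁻ n, f (R (Fin.cons (∑ k, g k ^ 2) n)) ∂μ) hrow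
  rw [lintegral_map hm3 (by fun_prop), lintegral_map hm3 (by fun_prop)] at h
  refine (lintegral_congr fun Y => ?_).trans h
  refine congrArg (fun y => f (R y)) (funext fun i => ?_)
  refine Fin.cases ?_ (fun j => ?_) i
  · simp [MeasurableEquiv.piFinSuccAbove, sq]
  · simp [MeasurableEquiv.piFinSuccAbove]

lemma exists_linearIsometryEquiv_single_eq {m : ℕ} {v : Fin (m + 1) → ℝ} (hv : v ⬝ᵥ v = 1) :
    ∃ U : EuclideanSpace ℝ (Fin (m + 1)) ≃ₗᵢ[ℝ] EuclideanSpace ℝ (Fin (m + 1)),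
      U (EuclideanSpace.single 0 1) = WithLp.toLp 2 v := by
  have hn : ‖WithLp.toLp 2 v‖ = 1 := by
    rw [EuclideanSpace.norm_eq, Real.sqrt_eq_one]
    simpa [dotProduct, sq] using hv
  have ho : Orthonormal ℝ (({0} : Set (Fin (m + 1))).domRestrict fun _ => WithLp.toLp 2 v) :=
    ⟨fun _ => hn, fun i j hij => (hij (Subsingleton.elim i j)).elim⟩
  obtain ⟨b, hb⟩ := ho.exists_orthonormalBasis_extension_of_card_eq (by simp)
  refine ⟨b.repr.symm, ?_⟩
  rw [b.repr_symm_single]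
  exact hb 0 rfl

lemma measurable_mul_transpose_mulVec {m r : ℕ} (v : Fin m → ℝ) :
    Measurable fun W : Fin m → Fin r → ℝ => (Matrix.of W * (Matrix.of W)ᵀ) *ᵥ v := by
  refine measurable_pi_iff.2 fun i => ?_
  simp only [mulVec, dotProduct, mul_apply, of_apply, transpose_apply]
  fun_prop

lemma measure_setOf_mem_eq_lintegral {X Y : Type*} [MeasurableSpace X] [MeasurableSpace Y]
    (μ : Measure X) {g : X → Y} (hg : Measurable g) {A : Set Y} (hA : MeasurableSet A) :
    μ {x | g x ∈ A} = ∫⁻ x, A.indicator 1 (g x) ∂μ :=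
  (lintegral_indicator_one (hg hA)).symm

lemma measure_mul_transpose_mulVec_eq_prod (m r : ℕ)
    (U : EuclideanSpace ℝ (Fin (m + 1)) ≃ₗᵢ[ℝ] EuclideanSpace ℝ (Fin (m + 1)))
    (v : Fin (m + 1) → ℝ) (hU : U (EuclideanSpace.single 0 1) = WithLp.toLp 2 v)
    {A : Set (Fin (m + 1) → ℝ)} (hA : MeasurableSet A) :
    (Measure.pi fun _ : Fin (m + 1) => gaussPi (Fin r))
        {W | (Matrix.of W * (Matrix.of W)ᵀ) *ᵥ v ∈ A}
      = ((gaussPi (Fin r)).prod (gaussPi (Fin m)))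
          {p | (U (WithLp.toLp 2 (wishartColumn p.1 p.2))).ofLp ∈ A} := by
  have hm : Measurable fun p : (Fin r → ℝ) × (Fin m → ℝ) =>
      (U (WithLp.toLp 2 (wishartColumn p.1 p.2))).ofLp := by
    have := measurable_wishartColumn m r
    fun_prop
  have h := lintegral_mul_transpose_mulVec m r U v hU (f := A.indicator 1)
    (measurable_one.indicator hA)
  rw [measure_setOf_mem_eq_lintegral _ (measurable_mul_transpose_mulVec v) hA,
    measure_setOf_mem_eq_lintegral _ hm hA]
  exact h.trans (lintegral_prod _ ((measurable_one.indicator hA).comp hm).aemeasurable).symm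

lemma measure_mul_transpose_mulVec_eq_lintegral (m r : ℕ) (hr : 1 ≤ r) :
    ∃ C : ENNReal, ∀ v : Fin (m + 1) → ℝ, v ⬝ᵥ v = 1 →
      ∀ A : Set (Fin (m + 1) → ℝ), MeasurableSet A →
        (Measure.pi fun _ : Fin (m + 1) => gaussPi (Fin r))
            {W | (Matrix.of W * (Matrix.of W)ᵀ) *ᵥ v ∈ A}
          = C * ∫⁻ y in A, wishartKernel m r (v ⬝ᵥ y) (y ⬝ᵥ y) := by
  obtain ⟨C, hC⟩ := lintegral_wishartColumn_eq_volume m r hr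
  refine ⟨C, fun v hv A hA => ?_⟩
  obtain ⟨U, hU⟩ := exists_linearIsometryEquiv_single_eq hv
  have hR := volume_map_linearIsometryEquiv U
  set R : (Fin (m + 1) → ℝ) → (Fin (m + 1) → ℝ) := fun x => (U (WithLp.toLp 2 x)).ofLp
  have hf : Measurable (A.indicator (1 : (Fin (m + 1) → ℝ) → ENNReal)) :=
    measurable_one.indicator hA
  rw [measure_setOf_mem_eq_lintegral _ (measurable_mul_transpose_mulVec v) hA,
    ← lintegral_indicator hA]
  have h0 (y : Fin (m + 1) → ℝ) : v ⬝ᵥ R y = y 0 := by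
    have h := U.inner_map_map (EuclideanSpace.single 0 1) (WithLp.toLp 2 y)
    rw [hU] at h
    simpa [EuclideanSpace.inner_eq_star_dotProduct, dotProduct_comm] using h
  have h1 (y : Fin (m + 1) → ℝ) : R y ⬝ᵥ R y = ∑ i, y i ^ 2 := by
    have h := U.inner_map_map (WithLp.toLp 2 y) (WithLp.toLp 2 y)
    rw [EuclideanSpace.inner_eq_star_dotProduct, EuclideanSpace.inner_eq_star_dotProduct] at h
    simpa [dotProduct, sq] using h
  have hK : Measurable fun y => A.indicator
      (fun y => wishartKernel m r (v ⬝ᵥ y) (y ⬝ᵥ y)) y := by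
    refine Measurable.indicator ?_ hA
    refine (measurable_wishartKernel m r).comp
      (f := fun y : Fin (m + 1) → ℝ => (v ⬝ᵥ y, y ⬝ᵥ y)) ?_
    simp only [dotProduct]
    fun_prop
  rw [← hR.lintegral_comp hK]
  refine (lintegral_mul_transpose_mulVec m r U v hU hf).trans
    ((hC (fun y => A.indicator 1 (R y)) (hf.comp hR.measurable)).trans ?_)
  congr 1
  refine lintegral_congr fun y => ?_
  by_cases hy : R y ∈ A <;> simp [hy, h0, h1]

lemma map_sum_sq_gaussPi (r : ℕ) :
    (gaussPi (Fin r)).map (fun x => ∑ i, x i ^ 2) = chiSq r := rfl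

lemma map_prod_eq_chiSq (r m : ℕ) :
    ((gaussPi (Fin r)).prod (gaussPi (Fin m))).map
      (fun p => ∑ i, p.1 i ^ 2 + ∑ i, p.2 i ^ 2) = chiSq (r + m) := by
  have h1 := (measurePreserving_sumPiEquivProdPi
    (fun _ : Fin r ⊕ Fin m => gaussianReal 0 1)).map_eq
  have h2 := (measurePreserving_piCongrLeft
    (fun _ : Fin r ⊕ Fin m => gaussianReal 0 1) finSumFinEquiv.symm).map_eq
  rw [← map_sum_sq_gaussPi]
  simp only [gaussPi]
  rw [← h1, ← h2, Measure.map_map (by fun_prop) (by fun_prop),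
    Measure.map_map (by fun_prop) (by fun_prop)]
  congr 1
  ext x
  simp [MeasurableEquiv.sumPiEquivProdPi, MeasurableEquiv.piCongrLeft, Fin.sum_univ_add,
    Equiv.piCongrLeft, Equiv.sumPiEquivProdPi]

lemma map_prod_eq_studentT (r m : ℕ) (u : Fin m → ℝ) {c : ℝ} (hc : 0 < c)
    (hu : ∑ i, u i ^ 2 = c ^ 2) :
    ((gaussPi (Fin r)).prod (gaussPi (Fin m))).map
      (fun p => (∑ i, u i * p.2 i) / c / √((∑ i, p.1 i ^ 2) / r)) = studentT r := by
  have h1 : (gaussPi (Fin m)).map (fun x => ∑ i, (u i / c) * x i) = gaussianReal 0 1 := by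
    rw [map_sum_mul_gaussPi]
    congr 1
    simp only [div_pow, ← Finset.sum_div, hu]
    rw [div_self (by positivity)]
    simp
  rw [studentT, ← map_sum_sq_gaussPi, ← h1, Measure.map_prod_map _ _ (by fun_prop) (by fun_prop),
    ← Measure.prod_swap, Measure.map_map (by fun_prop) (by fun_prop),
    Measure.map_map (by fun_prop) (by fun_prop)]
  congr 1
  ext x
  simp only [Function.comp_apply, Prod.map, Prod.swap, Finset.sum_div, div_mul_eq_mul_div]

lemma le_measure_Iic_quantile (μ : Measure ℝ) [IsProbabilityMeasure μ] {p : ℝ} (hp1 : p < 1) :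
    p ≤ μ.real (Set.Iic (quantile μ p)) := by
  have hS : {x : ℝ | p ≤ (μ (Set.Iic x)).toReal} = {x | p ≤ cdf μ x} := by
    ext x
    simp [cdf_eq_real, Measure.real]
  rw [← cdf_eq_real, quantile, hS]
  set S := {x | p ≤ cdf μ x}
  have hne : S.Nonempty :=
    ((tendsto_cdf_atTop μ).eventually (eventually_ge_nhds hp1)).exists
  have hgt : ∀ x, sInf S < x → p ≤ cdf μ x := fun x hx => by
    obtain ⟨y, hy, hyx⟩ := exists_lt_of_csInf_lt hne hx
    exact le_trans hy (monotone_cdf μ hyx.le)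
  have hcont := ((cdf μ).right_continuous (sInf S)).mono Set.Ioi_subset_Ici_self
  exact ge_of_tendsto hcont (eventually_mem_nhdsWithin.mono fun x hx => hgt x hx)

lemma measure_Ioi_quantile_le (μ : Measure ℝ) [IsProbabilityMeasure μ] {p : ℝ} (hp0 : 0 < p) :
    μ (Set.Ioi (quantile μ (1 - p))) ≤ ENNReal.ofReal p := by
  have h := le_measure_Iic_quantile μ (p := 1 - p) (by linarith)
  rw [← Set.compl_Iic, ← ofReal_measureReal]
  refine ENNReal.ofReal_le_ofReal ?_
  rw [probReal_compl_eq_one_sub measurableSet_Iic]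
  linarith

lemma wishartKernel_le {m r : ℕ} (hr : r ≤ m) {s s' t l u b : ℝ} (hl : 0 < l) (hlu : l + u ≤ 2)
    (hls : l * s ≤ s') (hus : s' ≤ u * s) (ht : 0 ≤ t) (htb : t ≤ b * s) :
    wishartKernel m r s t
      ≤ ENNReal.ofReal (Real.exp (((m : ℝ) + 2 - r) / 2 * Real.log u + b / 2 * (1 / l - 1)))
        * wishartKernel m r s' t := by
  by_cases hs : 0 < s
  swap
  · simp [wishartKernel, hs]
  have hs' : 0 < s' := (mul_pos hl hs).trans_le hls
  have hu : 0 < u := pos_of_mul_pos_left (hs'.trans_le hus) hs.le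
  have hl1 : l ≤ 1 := by
    have : l ≤ u := le_of_mul_le_mul_right (hls.trans hus) hs
    linarith
  simp only [wishartKernel, Set.indicator, Set.mem_Ioi, hs, hs', if_true]
  rw [← ENNReal.ofReal_mul (by positivity)]
  refine ENNReal.ofReal_le_ofReal ?_
  rw [Real.rpow_def_of_pos hs, Real.rpow_def_of_pos hs', ← Real.exp_add, ← Real.exp_add,
    ← Real.exp_add]
  refine Real.exp_le_exp.2 ?_
  have hlog : Real.log s' ≤ Real.log u + Real.log s := by
    rw [← Real.log_mul hu.ne' hs.ne']
    exact Real.log_le_log hs' hus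
  have hrm : (r : ℝ) ≤ m := by exact_mod_cast hr
  have h1 : 0 ≤ ((m : ℝ) + 2 - r) / 2 * (Real.log u + Real.log s - Real.log s') :=
    mul_nonneg (by linarith) (by linarith)
  have hl2 : 0 ≤ 1 / l - 1 := by
    rw [sub_nonneg, le_div_iff₀ hl]
    linarith
  have h2 : t / s' ≤ t / (l * s) := div_le_div_of_nonneg_left ht (mul_pos hl hs) hls
  have h3 : t / s * (1 / l - 1) ≤ b * (1 / l - 1) :=
    mul_le_mul_of_nonneg_right ((div_le_iff₀ hs).2 htb) hl2
  have h4 : t / s * (1 / l - 1) = t / (l * s) - t / s := by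
    field_simp
  have h5 : -t / (2 * s) = -(t / s) / 2 := by ring
  have h6 : -t / (2 * s') = -(t / s') / 2 := by ring
  rw [h5, h6]
  nlinarith

instance isProbabilityMeasure_chiSq (k : ℕ) : IsProbabilityMeasure (chiSq k) :=
  Measure.isProbabilityMeasure_map (Measurable.aemeasurable (by fun_prop))

instance isProbabilityMeasure_studentT (r : ℕ) : IsProbabilityMeasure (studentT r) :=
  Measure.isProbabilityMeasure_map (Measurable.aemeasurable (by fun_prop))

lemma measure_mul_transpose_mulVec_bad_le (m r : ℕ) {v v' : Fin (m + 1) → ℝ} (hv : v ⬝ᵥ v = 1)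
    (hv' : v' ⬝ᵥ v' = 1) {ρ : ℝ} (hρ : ρ = v ⬝ᵥ v') (hρ1 : ρ ^ 2 < 1) {δ : ℝ} (hδ : 0 < δ) :
    (Measure.pi fun _ : Fin (m + 1) => gaussPi (Fin r))
      {W | (Matrix.of W * (Matrix.of W)ᵀ) *ᵥ v ∈ {y : Fin (m + 1) → ℝ |
        (ρ - √((1 - ρ ^ 2) / r) * quantile (studentT r) (1 - δ)) * (v ⬝ᵥ y) ≤ v' ⬝ᵥ y ∧
        v' ⬝ᵥ y ≤ (ρ + √((1 - ρ ^ 2) / r) * quantile (studentT r) (1 - δ)) * (v ⬝ᵥ y) ∧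
        y ⬝ᵥ y ≤ quantile (chiSq (r + m)) (1 - δ) * (v ⬝ᵥ y)}ᶜ} ≤ ENNReal.ofReal (3 * δ) := by
  set q := quantile (studentT r) (1 - δ) with hq
  set b := quantile (chiSq (r + m)) (1 - δ) with hb
  obtain ⟨U, hU⟩ := exists_linearIsometryEquiv_single_eq hv
  rw [measure_mul_transpose_mulVec_eq_prod m r U v hU (by measurability)]
  set w : Fin (m + 1) → ℝ := (U.symm (WithLp.toLp 2 v')).ofLp
  have hdot (x y : Fin (m + 1) → ℝ) : x ⬝ᵥ (U (WithLp.toLp 2 y)).ofLp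
      = (U.symm (WithLp.toLp 2 x)).ofLp ⬝ᵥ y := by
    have h := U.inner_map_map (U.symm (WithLp.toLp 2 x)) (WithLp.toLp 2 y)
    rw [EuclideanSpace.inner_eq_star_dotProduct, EuclideanSpace.inner_eq_star_dotProduct] at h
    simpa [dotProduct_comm] using h
  have hv0 (y : Fin (m + 1) → ℝ) : v ⬝ᵥ (U (WithLp.toLp 2 y)).ofLp = y 0 := by
    rw [hdot, ← hU]
    simp
  have hyy (y : Fin (m + 1) → ℝ) :
      (U (WithLp.toLp 2 y)).ofLp ⬝ᵥ (U (WithLp.toLp 2 y)).ofLp = y ⬝ᵥ y := by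
    rw [hdot]
    simp
  have hw0 : w 0 = ρ := by
    have h := hdot v' (Pi.single 0 1)
    rw [dotProduct_single_one] at h
    rw [show w 0 = _ from h.symm, hρ, dotProduct_comm]
    congr 1
    exact (congrArg WithLp.ofLp hU)
  have hw : w ⬝ᵥ w = 1 := by
    rw [← hyy, ← hv']
    simp [w]
  set u : Fin m → ℝ := fun i => w i.succ
  set c := √(1 - ρ ^ 2)
  have hc : 0 < c := Real.sqrt_pos.2 (by linarith)
  have hu : ∑ i, u i ^ 2 = c ^ 2 := by
    rw [dotProduct, Fin.sum_univ_succ, hw0] at hw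
    rw [Real.sq_sqrt (by linarith), ← hw]
    simp [u, sq]
  set P := (gaussPi (Fin r)).prod (gaussPi (Fin m))
  have hT (u : Fin m → ℝ) (hu : ∑ i, u i ^ 2 = c ^ 2) :
      P {p | q < (∑ i, u i * p.2 i) / c / √((∑ i, p.1 i ^ 2) / r)} ≤ ENNReal.ofReal δ := by
    have h := measure_Ioi_quantile_le (studentT r) hδ
    rwa [← hq, ← map_prod_eq_studentT r m u hc hu,
      Measure.map_apply (by fun_prop) measurableSet_Ioi] at h
  have hX : P {p | b < ∑ i, p.1 i ^ 2 + ∑ i, p.2 i ^ 2} ≤ ENNReal.ofReal δ := by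
    have h := measure_Ioi_quantile_le (chiSq (r + m)) hδ
    rwa [← hb, ← map_prod_eq_chiSq, Measure.map_apply (by fun_prop) measurableSet_Ioi] at h
  have hsum : ENNReal.ofReal (3 * δ)
      = ENNReal.ofReal δ + ENNReal.ofReal δ + ENNReal.ofReal δ := by
    rw [← ENNReal.ofReal_add hδ.le hδ.le, ← ENNReal.ofReal_add (by positivity) hδ.le]
    congr 1
    ring
  rw [hsum]
  refine le_trans (measure_mono ?_) ((measure_union_le _ _).trans (add_le_add
    ((measure_union_le _ _).trans (add_le_add (hT u hu) (hT (fun i => -u i) (by simpa using hu))))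
    hX))
  rintro ⟨g, n⟩ hp
  contrapose! hp
  simp only [Set.mem_union, Set.mem_ofPred_eq, not_or, not_lt] at hp
  obtain ⟨⟨h1, h2⟩, h3⟩ := hp
  simp only [Set.mem_ofPred_eq, Set.mem_compl_iff, not_not]
  set s := ∑ i, g i ^ 2
  have hs : 0 ≤ s := Finset.sum_nonneg fun _ _ => sq_nonneg _
  have hss : √s * √s = s := Real.mul_self_sqrt hs
  set x := ∑ i, u i * n i
  have hx : v' ⬝ᵥ (U (WithLp.toLp 2 (wishartColumn g n))).ofLp = ρ * s + √s * x := by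
    rw [hdot, dotProduct, Fin.sum_univ_succ]
    change w 0 * _ + ∑ i : Fin m, u i * _ = _
    rw [hw0]
    simp only [wishartColumn, Fin.cons_zero, Fin.cons_succ, Pi.smul_apply, smul_eq_mul]
    congr 1
    exact (Finset.sum_congr rfl fun i _ => mul_left_comm _ _ _).trans (Finset.mul_sum _ _ _).symm
  have hn : wishartColumn g n ⬝ᵥ wishartColumn g n = (s + ∑ i, n i ^ 2) * s := by
    rw [dotProduct, Fin.sum_univ_succ]
    simp only [wishartColumn, Fin.cons_zero, Fin.cons_succ, Pi.smul_apply, smul_eq_mul,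
      mul_mul_mul_comm _ _ (√_), ← sq, ← Finset.mul_sum]
    rw [Real.sq_sqrt hs]
    ring
  rw [hv0, hx, hyy, hn]
  have hcol : wishartColumn g n 0 = s := by simp [wishartColumn, s]
  rw [hcol]
  have key (z : ℝ) (hz : z / c / √(s / r) ≤ q) : √s * z ≤ √((1 - ρ ^ 2) / r) * q * s := by
    rcases hs.eq_or_lt with hs0 | hs0
    · simp [← hs0]
    rcases Nat.eq_zero_or_pos r with rfl | hr
    · simp [s] at hs0
    have hr0 : (0 : ℝ) < r := by exact_mod_cast hr
    rw [div_le_iff₀ (Real.sqrt_pos.2 (by positivity)), div_le_iff₀ hc] at hz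
    calc √s * z ≤ √s * (q * √(s / r) * c) := mul_le_mul_of_nonneg_left hz (Real.sqrt_nonneg _)
      _ = √((1 - ρ ^ 2) / r) * q * s := by
        rw [Real.sqrt_div hs, Real.sqrt_div (by linarith)]
        conv_rhs => rw [← hss]
        ring
  have hk1 := key x h1
  have hk2 := key (-x) (by simpa [x] using h2)
  refine ⟨by nlinarith, by nlinarith, mul_le_mul_of_nonneg_right h3 hs⟩

lemma measure_scaled_mul_transpose_mulVec_eq (m r : ℕ) (v : Fin m → ℝ)
    {A : Set (Fin m → ℝ)} (hA : MeasurableSet A) :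
    (Measure.pi fun _ : Fin m => Measure.pi fun _ : Fin r => gaussianReal 0 (r : NNReal)⁻¹)
        {W | (Matrix.of W * (Matrix.of W)ᵀ) *ᵥ v ∈ A}
      = (Measure.pi fun _ : Fin m => gaussPi (Fin r))
        {W | (Matrix.of W * (Matrix.of W)ᵀ) *ᵥ v ∈ {y | (r : ℝ)⁻¹ • y ∈ A}} := by
  have h1 : (gaussianReal 0 1).map (fun x => (√r)⁻¹ * x) = gaussianReal 0 (r : NNReal)⁻¹ := by
    rw [map_smul_gaussianReal]
    congr 1
    ext
    rw [Real.coe_toNNReal _ (sq_nonneg _), inv_pow, Real.sq_sqrt (Nat.cast_nonneg r)]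
    simp
  have h2 : (gaussPi (Fin r)).map (fun x i => (√r)⁻¹ * x i)
      = Measure.pi fun _ : Fin r => gaussianReal 0 (r : NNReal)⁻¹ := by
    rw [Measure.pi_map_pi (f := fun _ (x : ℝ) => (√r)⁻¹ * x) (fun _ => by fun_prop), h1]
  have h3 : (Measure.pi fun _ : Fin m => gaussPi (Fin r)).map (fun W i k => (√r)⁻¹ * W i k)
      = Measure.pi fun _ : Fin m => Measure.pi fun _ : Fin r => gaussianReal 0 (r : NNReal)⁻¹ := by
    rw [Measure.pi_map_pi (f := fun _ (x : Fin r → ℝ) i => (√r)⁻¹ * x i)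
      (fun _ => Measurable.aemeasurable (by fun_prop)), h2]
  rw [← h3]
  refine (Measure.map_apply (by fun_prop) (measurable_mul_transpose_mulVec v hA)).trans ?_
  congr 1
  ext W
  have : Matrix.of (fun i k => (√(r : ℝ))⁻¹ * W i k) = (√(r : ℝ))⁻¹ • Matrix.of W := rfl
  simp only [Set.mem_preimage, Set.mem_ofPred_eq]
  rw [this, transpose_smul, Matrix.smul_mul, Matrix.mul_smul, smul_smul, ← mul_inv,
    Real.mul_self_sqrt (Nat.cast_nonneg r), smul_mulVec]

/-- privacy guarantee for the vector-valued Wishart projection mechanism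
`v ↦ M v` with `M = Z Zᵀ`, `Z` a `d × r` matrix with i.i.d. `N(0, 1/r)` entries. -/
theorem stmt0
    {Ω : Type} [MeasureSpace Ω] [IsProbabilityMeasure (ℙ : Measure Ω)]
    (d r : ℕ) (hr : 1 ≤ r) (hdr : r < d)
    (Z : Ω → Fin d → Fin r → ℝ)
    (hZ : Measure.map Z ℙ
      = Measure.pi fun _ : Fin d => Measure.pi fun _ : Fin r => gaussianReal 0 (r : NNReal)⁻¹)
    (v v' : Fin d → ℝ) (hv : v ⬝ᵥ v = 1) (hv' : v' ⬝ᵥ v' = 1)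
    (ρ : ℝ) (hρ : ρ = v ⬝ᵥ v') (hρ0 : 0 < ρ) (hρ1 : ρ < 1)
    (δ' : ℝ) (hδ' : δ' ∈ Set.Ioo (0 : ℝ) 1)
    (q : ℝ) (hq : q = quantile (studentT r) (1 - δ' / 3))
    (aminus aplus : ℝ)
    (haminus : aminus = ρ - Real.sqrt ((1 - ρ ^ 2) / r) * q)
    (haplus : aplus = ρ + Real.sqrt ((1 - ρ ^ 2) / r) * q)
    (b : ℝ) (hb : b = quantile (chiSq (d + r - 1)) (1 - δ' / 3))
    (haminus_pos : 0 < aminus)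
    (ε : ℝ) (hε : ε = ((d : ℝ) - r + 1) / 2 * Real.log aplus + b / 2 * (1 / aminus - 1))
    (δsupp : ℝ)
    (hδsupp : δsupp = ∫ x, Phi (-ρ * Real.sqrt x / Real.sqrt (1 - ρ ^ 2)) ∂(chiSq r)) :
    ∀ A : Set (Fin d → ℝ), MeasurableSet A →
      ℙ {ω | (Matrix.of (Z ω) * (Matrix.of (Z ω))ᵀ) *ᵥ v ∈ A}
        ≤ ENNReal.ofReal (Real.exp ε) * ℙ {ω | (Matrix.of (Z ω) * (Matrix.of (Z ω))ᵀ) *ᵥ v' ∈ A}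
          + ENNReal.ofReal (δ' + δsupp) := by
  intro A hA
  obtain ⟨m, rfl⟩ : ∃ m, d = m + 1 := ⟨d - 1, by omega⟩
  have hrm : r ≤ m := by omega
  have hρ2 : ρ ^ 2 < 1 := by nlinarith
  have hZm : AEMeasurable Z ℙ := by
    by_contra h
    rw [Measure.map_of_not_aemeasurable h] at hZ
    exact IsProbabilityMeasure.ne_zero _ hZ.symm
  set γ := Measure.pi fun _ : Fin (m + 1) => gaussPi (Fin r)
  set A' : Set (Fin (m + 1) → ℝ) := {y | (r : ℝ)⁻¹ • y ∈ A}
  have hA' : MeasurableSet A' :=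
    hA.preimage (f := fun y : Fin (m + 1) → ℝ => (r : ℝ)⁻¹ • y) (by fun_prop)
  have hlaw (x : Fin (m + 1) → ℝ) : ℙ {ω | (Matrix.of (Z ω) * (Matrix.of (Z ω))ᵀ) *ᵥ x ∈ A}
      = γ {W | (Matrix.of W * (Matrix.of W)ᵀ) *ᵥ x ∈ A'} := by
    rw [← measure_scaled_mul_transpose_mulVec_eq (m + 1) r x hA, ← hZ]
    exact (Measure.map_apply_of_aemeasurable hZm (measurable_mul_transpose_mulVec x hA)).symm
  rw [hlaw, hlaw]
  have hbad := measure_mul_transpose_mulVec_bad_le m r hv hv' hρ hρ2 (δ := δ' / 3)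
    (div_pos hδ'.1 three_pos)
  rw [show r + m = m + 1 + r - 1 by omega, ← hb, ← hq, ← haminus, ← haplus,
    mul_div_cancel₀ δ' three_ne_zero] at hbad
  set G : Set (Fin (m + 1) → ℝ) := {y | aminus * (v ⬝ᵥ y) ≤ v' ⬝ᵥ y ∧
    v' ⬝ᵥ y ≤ aplus * (v ⬝ᵥ y) ∧ y ⬝ᵥ y ≤ b * (v ⬝ᵥ y)}
  have hGm : MeasurableSet G := by measurability
  obtain ⟨C, hC⟩ := measure_mul_transpose_mulVec_eq_lintegral m r hr
  have hgood : γ {W | (Matrix.of W * (Matrix.of W)ᵀ) *ᵥ v ∈ A' ∩ G}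
      ≤ ENNReal.ofReal (Real.exp ε) * γ {W | (Matrix.of W * (Matrix.of W)ᵀ) *ᵥ v' ∈ A'} := by
    have hker : Measurable fun y : Fin (m + 1) → ℝ => wishartKernel m r (v' ⬝ᵥ y) (y ⬝ᵥ y) :=
      (measurable_wishartKernel m r).comp
        (f := fun y : Fin (m + 1) → ℝ => (v' ⬝ᵥ y, y ⬝ᵥ y))
        (by simp only [dotProduct]; fun_prop)
    rw [hC v hv _ (hA'.inter hGm), hC v' hv' _ hA', mul_left_comm, ← lintegral_const_mul _ hker]
    refine mul_le_mul' le_rfl ?_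
    refine (setLIntegral_mono (hker.const_mul _) fun y hy => ?_).trans
      (lintegral_mono_set Set.inter_subset_left)
    obtain ⟨-, h1, h2, h3⟩ := hy
    have h := wishartKernel_le hrm haminus_pos (by linarith) h1 h2
      (Finset.sum_nonneg fun i _ => mul_self_nonneg (y i)) h3
    rw [hε, show ((m + 1 : ℕ) : ℝ) - r + 1 = m + 2 - r by push_cast; ring]
    exact h
  have hδ0 : 0 ≤ δsupp := hδsupp ▸ integral_nonneg fun _ => ENNReal.toReal_nonneg
  calc γ {W | (Matrix.of W * (Matrix.of W)ᵀ) *ᵥ v ∈ A'}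
      ≤ γ ({W | (Matrix.of W * (Matrix.of W)ᵀ) *ᵥ v ∈ A' ∩ G}
          ∪ {W | (Matrix.of W * (Matrix.of W)ᵀ) *ᵥ v ∈ Gᶜ}) :=
        measure_mono fun W hW => (em _).imp (fun h => ⟨hW, h⟩) id
    _ ≤ _ := (measure_union_le _ _).trans (add_le_add hgood
        (hbad.trans (ENNReal.ofReal_le_ofReal (by linarith))))
end

section
/- Let d, r ≥ 1 be integers, let z₁, …, z_r be i.i.d. N(0, (1/r) I_d) random vectors in ℝ^d, and set M := Σ_{k=1}^r z_k z_kᵀ. Let v, v′ ∈ ℝ^d be unit vectors with ρ := ⟨v, v′⟩ ∈ (0,1). Then ℙ((v′)ᵀ M v ≤ 0) = E_{X∼χ²_r}[ Φ( −ρ√X / √(1−ρ²) ) ], where Φ is the standard normal CDF. -/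
open MeasureTheory ProbabilityTheory Matrix

lemma charFunDual_gaussianReal_zero (σ : NNReal) (L : StrongDual ℝ ℝ) :
    charFunDual (gaussianReal 0 σ) L = Complex.exp (-(σ * L 1 ^ 2 / 2 : ℝ)) := by
  rw [charFunDual_eq_charFun_map_one, gaussianReal_map_continuousLinearMap, charFun_gaussianReal]
  congr 1
  simp [max_eq_left (sq_nonneg (L 1))]
  ring

lemma charFunDual_pi_gaussianReal_zero {n : ℕ} (σ : NNReal) (L : StrongDual ℝ (Fin n → ℝ)) :
    charFunDual (Measure.pi fun _ : Fin n => gaussianReal 0 σ) L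
      = Complex.exp (-(σ * (∑ i, L (Pi.single i 1) ^ 2) / 2 : ℝ)) := by
  rw [charFunDual_pi]
  simp_rw [charFunDual_gaussianReal_zero]
  rw [← Complex.exp_sum]
  congr 1
  simp [Finset.mul_sum, Finset.sum_div]

/-- The linear form `x ↦ w ⬝ᵥ x`. -/
noncomputable def dotCLM {n : ℕ} (w : Fin n → ℝ) : StrongDual ℝ (Fin n → ℝ) :=
  ∑ i, w i • ContinuousLinearMap.proj (R := ℝ) (φ := fun _ : Fin n => ℝ) i

@[simp]
lemma dotCLM_apply {n : ℕ} (w x : Fin n → ℝ) : dotCLM w x = w ⬝ᵥ x := by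
  simp [dotCLM, dotProduct]

/-- A linear form in i.i.d. standard Gaussian variables is Gaussian. -/
lemma map_dotProduct_pi_gaussianReal {n : ℕ} (a : Fin n → ℝ) :
    (Measure.pi fun _ : Fin n => gaussianReal 0 1).map (a ⬝ᵥ ·)
      = (gaussianReal 0 1).map (Real.sqrt (a ⬝ᵥ a) * ·) := by
  have ha : 0 ≤ a ⬝ᵥ a := Finset.sum_nonneg fun i _ => mul_self_nonneg _
  have h1 : (a ⬝ᵥ ·) = ⇑(dotCLM a) := by ext x; simp
  have h2 : (Real.sqrt (a ⬝ᵥ a) * ·) = ⇑(Real.sqrt (a ⬝ᵥ a) • ContinuousLinearMap.id ℝ ℝ) := by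
    ext x; simp
  rw [h1, h2]
  have := Measure.isProbabilityMeasure_map (μ := Measure.pi fun _ : Fin n => gaussianReal 0 1)
    (dotCLM a).continuous.aemeasurable
  have := Measure.isProbabilityMeasure_map (μ := gaussianReal 0 1)
    (Real.sqrt (a ⬝ᵥ a) • ContinuousLinearMap.id ℝ ℝ).continuous.aemeasurable
  refine Measure.ext_of_charFunDual (funext fun L => ?_)
  rw [charFunDual_map, charFunDual_map, charFunDual_pi_gaussianReal_zero,
    charFunDual_gaussianReal_zero]
  have hL (y : ℝ) : L y = y * L 1 := by
    simpa using L.map_smul y 1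
  congr 4
  simp only [ContinuousLinearMap.comp_apply, dotCLM_apply, dotProduct_single, mul_one]
  simp_rw [hL (a _), mul_pow, ← Finset.sum_mul]
  simp [hL (Real.sqrt _), mul_pow, Real.sq_sqrt ha]
  left
  simp [dotProduct, sq]

/-- Orthonormal (up to the common scale) linear forms in i.i.d. centered Gaussian variables are
independent standard Gaussians. -/
lemma map_dotProduct_pair_pi_gaussianReal {n : ℕ} (σ : NNReal) (w u : Fin n → ℝ)
    (hw : σ * (w ⬝ᵥ w) = 1) (hu : σ * (u ⬝ᵥ u) = 1) (hwu : w ⬝ᵥ u = 0) :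
    (Measure.pi fun _ : Fin n => gaussianReal 0 σ).map (fun x => (w ⬝ᵥ x, u ⬝ᵥ x))
      = (gaussianReal 0 1).prod (gaussianReal 0 1) := by
  have h1 : (fun x => (w ⬝ᵥ x, u ⬝ᵥ x)) = ⇑((dotCLM w).prod (dotCLM u)) := by ext x <;> simp
  rw [h1]
  have := Measure.isProbabilityMeasure_map (μ := Measure.pi fun _ : Fin n => gaussianReal 0 σ)
    ((dotCLM w).prod (dotCLM u)).continuous.aemeasurable
  refine Measure.ext_of_charFunDual (funext fun L => ?_)
  rw [charFunDual_map, charFunDual_prod, charFunDual_pi_gaussianReal_zero,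
    charFunDual_gaussianReal_zero, charFunDual_gaussianReal_zero, ← Complex.exp_add]
  have hL (p : ℝ × ℝ) : L p = p.1 * L (1, 0) + p.2 * L (0, 1) := by
    rw [← smul_eq_mul, ← smul_eq_mul, ← map_smul, ← map_smul, ← map_add]
    simp
  have key : σ * (∑ i, ((L.comp ((dotCLM w).prod (dotCLM u))) (Pi.single i 1)) ^ 2)
      = L (1, 0) ^ 2 + L (0, 1) ^ 2 := by
    have : ∑ i, ((L.comp ((dotCLM w).prod (dotCLM u))) (Pi.single i 1)) ^ 2
        = (w ⬝ᵥ w) * L (1, 0) ^ 2 + (u ⬝ᵥ u) * L (0, 1) ^ 2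
          + 2 * (w ⬝ᵥ u) * (L (1, 0) * L (0, 1)) := by
      simp only [ContinuousLinearMap.comp_apply, ContinuousLinearMap.prod_apply, dotCLM_apply,
        dotProduct_single, mul_one]
      simp_rw [hL (w _, _), dotProduct, Finset.mul_sum, Finset.sum_mul, ← Finset.sum_add_distrib]
      exact Finset.sum_congr rfl fun i _ => by ring
    rw [this, hwu]
    linear_combination L (1, 0) ^ 2 * hw + L (0, 1) ^ 2 * hu
  rw [key]
  simp
  ring_nf

lemma measurable_Phi : Measurable Phi :=
  Monotone.measurable fun _ _ h => ENNReal.toReal_mono (measure_ne_top _ _)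
    (measure_mono (Set.Iic_subset_Iic.2 h))

lemma pi_gaussianReal_halfspace {n : ℕ} {ρ s : ℝ} (hs : 0 < s) {a : Fin n → ℝ} (ha : a ≠ 0) :
    (Measure.pi fun _ : Fin n => gaussianReal 0 1) {g | ρ * (a ⬝ᵥ a) + s * (a ⬝ᵥ g) ≤ 0}
      = ENNReal.ofReal (Phi (-ρ * Real.sqrt (a ⬝ᵥ a) / s)) := by
  have ha0 : 0 ≤ a ⬝ᵥ a := Finset.sum_nonneg fun i _ => mul_self_nonneg _
  have hpos : 0 < a ⬝ᵥ a := ha0.lt_of_ne' fun h => ha (dotProduct_self_eq_zero.1 h)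
  have hq := Real.sqrt_pos.2 hpos
  have hqq := Real.mul_self_sqrt ha0
  have hm : MeasurableSet {t : ℝ | ρ * (a ⬝ᵥ a) + s * t ≤ 0} :=
    measurableSet_le (by fun_prop) (by fun_prop)
  have hd : Measurable fun x : Fin n → ℝ => a ⬝ᵥ x := by unfold dotProduct; fun_prop
  change (Measure.pi _) ((a ⬝ᵥ ·) ⁻¹' {t : ℝ | ρ * (a ⬝ᵥ a) + s * t ≤ 0}) = _
  rw [← Measure.map_apply hd hm, map_dotProduct_pi_gaussianReal,
    Measure.map_apply (by fun_prop) hm, Phi, ENNReal.ofReal_toReal (measure_ne_top _ _)]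
  congr 1
  ext t
  set q := Real.sqrt (a ⬝ᵥ a)
  simp only [Set.mem_preimage, Set.mem_ofPred_eq, Set.mem_Iic, le_div_iff₀ hs, ← hqq]
  constructor
  · intro h
    by_contra! h'
    nlinarith [mul_pos hq (sub_pos.2 h')]
  · intro h
    nlinarith [mul_nonneg hq.le (sub_nonneg.2 h)]

lemma prod_pi_gaussianReal_quadratic {r : ℕ} (hr : 1 ≤ r) {ρ s : ℝ} (hs : 0 < s) :
    ((Measure.pi fun _ : Fin r => gaussianReal 0 1).prod
        (Measure.pi fun _ : Fin r => gaussianReal 0 1))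
        {p | ρ * (p.1 ⬝ᵥ p.1) + s * (p.1 ⬝ᵥ p.2) ≤ 0}
      = ENNReal.ofReal (∫ x, Phi (-ρ * Real.sqrt x / s) ∂(chiSq r)) := by
  have : NullSingletonClass (gaussianReal 0 1) := nullSingletonClass_gaussianReal one_ne_zero
  have : NullSingletonClass (Measure.pi fun _ : Fin r => gaussianReal 0 1) :=
    Measure.pi_nullSingletonClass ⟨0, hr⟩
  have hm : MeasurableSet {p : (Fin r → ℝ) × (Fin r → ℝ) |
      ρ * (p.1 ⬝ᵥ p.1) + s * (p.1 ⬝ᵥ p.2) ≤ 0} :=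
    measurableSet_le (by unfold dotProduct; fun_prop) (by fun_prop)
  have hPhi : Measurable fun x : ℝ => Phi (-ρ * Real.sqrt x / s) :=
    measurable_Phi.comp (by fun_prop)
  have hsq : Measurable fun x : Fin r → ℝ => ∑ i, (x i) ^ 2 := by fun_prop
  rw [Measure.prod_apply hm, chiSq, integral_map hsq.aemeasurable hPhi.aestronglyMeasurable,
    ofReal_integral_eq_lintegral_ofReal]
  · refine lintegral_congr_ae ?_
    filter_upwards [Measure.ae_ne _ (0 : Fin r → ℝ)] with a ha
    rw [Set.preimage_ofPred_eq, pi_gaussianReal_halfspace hs ha]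
    simp [dotProduct, sq]
  · refine Integrable.of_bound (hPhi.comp hsq).aestronglyMeasurable 1 (ae_of_all _ fun x => ?_)
    rw [Phi, Real.norm_of_nonneg ENNReal.toReal_nonneg]
    exact measureReal_le_one
  · exact ae_of_all _ fun x => ENNReal.toReal_nonneg

lemma dotProduct_sum_vecMulVec_mulVec {d r : ℕ} (z : Fin r → Fin d → ℝ) (v v' : Fin d → ℝ) :
    v' ⬝ᵥ ((∑ k, Matrix.vecMulVec (z k) (z k)) *ᵥ v) = ∑ k, (v ⬝ᵥ z k) * (v' ⬝ᵥ z k) := by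
  rw [Matrix.sum_mulVec, dotProduct_sum]
  refine Finset.sum_congr rfl fun k _ => ?_
  rw [vecMulVec_mulVec, dotProduct_comm v]
  simp [mul_comm]

/-- for `M = Σ z_k z_kᵀ` with `z_k` i.i.d. `N(0, (1/r) I_d)` and unit vectors
`v, v'` with `ρ = ⟨v, v'⟩ ∈ (0,1)`,
`ℙ((v')ᵀ M v ≤ 0) = E_{X∼χ²_r}[Φ(−ρ√X/√(1−ρ²))]`. -/
theorem stmt3
    {Ω : Type} [MeasureSpace Ω] [IsProbabilityMeasure (ℙ : Measure Ω)]
    (d r : ℕ) (hd : 1 ≤ d) (hr : 1 ≤ r)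
    (z : Ω → Fin r → Fin d → ℝ)
    (hz : Measure.map z ℙ
      = Measure.pi fun _ : Fin r => Measure.pi fun _ : Fin d =>
          gaussianReal 0 (r : NNReal)⁻¹)
    (v v' : Fin d → ℝ) (hv : v ⬝ᵥ v = 1) (hv' : v' ⬝ᵥ v' = 1)
    (ρ : ℝ) (hρ : ρ = v ⬝ᵥ v') (hρ0 : 0 < ρ) (hρ1 : ρ < 1) :
    ℙ {ω | v' ⬝ᵥ ((∑ k, Matrix.vecMulVec (z ω k) (z ω k)) *ᵥ v) ≤ 0}
      = ENNReal.ofReal (∫ x, Phi (-ρ * Real.sqrt x / Real.sqrt (1 - ρ ^ 2)) ∂(chiSq r)) := by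
  set s := Real.sqrt (1 - ρ ^ 2) with hs_def
  have hs : 0 < s := Real.sqrt_pos.2 (by nlinarith)
  have hss : s ^ 2 = 1 - ρ ^ 2 := Real.sq_sqrt (by nlinarith)
  have hr0 : (0 : ℝ) < r := by exact_mod_cast hr
  set q := Real.sqrt r with hq_def
  have hq : 0 < q := Real.sqrt_pos.2 hr0
  have hqq : q ^ 2 = r := Real.sq_sqrt hr0.le
  set w : Fin d → ℝ := q • v with hw_def
  set u : Fin d → ℝ := (q / s) • (v' - ρ • v) with hu_def
  have hpair := map_dotProduct_pair_pi_gaussianReal (r : NNReal)⁻¹ w u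
    (by
      simp [hw_def, hv]
      field_simp
      exact hqq)
    (by
      simp [hu_def, hv, hv', dotProduct_comm v' v, ← hρ]
      field_simp
      rw [hqq, hss])
    (by simp [hw_def, hu_def, hv, ← hρ, mul_comm q])
  have hmeas (c : Fin d → ℝ) : Measurable fun x : Fin d → ℝ => c ⬝ᵥ x := by
    unfold dotProduct; fun_prop
  have hmpair : Measurable fun x : Fin d → ℝ => (w ⬝ᵥ x, u ⬝ᵥ x) := (hmeas w).prodMk (hmeas u)
  have hz_ae : AEMeasurable z ℙ := by
    refine AEMeasurable.of_map_ne_zero ?_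
    rw [hz]
    exact IsProbabilityMeasure.ne_zero _
  have hset : MeasurableSet {p : (Fin r → ℝ) × (Fin r → ℝ) |
      ρ * (p.1 ⬝ᵥ p.1) + s * (p.1 ⬝ᵥ p.2) ≤ 0} :=
    measurableSet_le (by unfold dotProduct; fun_prop) (by fun_prop)
  have hcoords : (Measure.pi fun _ : Fin r => Measure.pi fun _ : Fin d =>
        gaussianReal 0 (r : NNReal)⁻¹).map (fun x k => (w ⬝ᵥ x k, u ⬝ᵥ x k))
      = Measure.pi fun _ : Fin r => (gaussianReal 0 1).prod (gaussianReal 0 1) := by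
    have : IsProbabilityMeasure ((Measure.pi fun _ : Fin d =>
        gaussianReal 0 (r : NNReal)⁻¹).map (fun x => (w ⬝ᵥ x, u ⬝ᵥ x))) :=
      Measure.isProbabilityMeasure_map hmpair.aemeasurable
    rw [Measure.pi_map_pi (fun _ => hmpair.aemeasurable), hpair]
  have hmp := measurePreserving_arrowProdEquivProdArrow ℝ ℝ (Fin r)
    (fun _ => gaussianReal 0 1) (fun _ => gaussianReal 0 1)
  have hmc : Measurable fun (x : Fin r → Fin d → ℝ) k => (w ⬝ᵥ x k, u ⬝ᵥ x k) :=
    measurable_pi_lambda _ fun k => hmpair.comp (measurable_pi_apply k)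
  rw [← prod_pi_gaussianReal_quadratic hr hs, ← hmp.map_eq, ← hcoords, ← hz,
    Measure.map_apply hmp.measurable hset, Measure.map_apply hmc (hmp.measurable hset),
    Measure.map_apply_of_aemeasurable hz_ae (hmc (hmp.measurable hset))]
  congr 1
  ext ω
  have hterm : ρ * ((fun k => w ⬝ᵥ z ω k) ⬝ᵥ fun k => w ⬝ᵥ z ω k)
      + s * ((fun k => w ⬝ᵥ z ω k) ⬝ᵥ fun k => u ⬝ᵥ z ω k)
      = r * ∑ k, (v ⬝ᵥ z ω k) * (v' ⬝ᵥ z ω k) := by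
    simp only [dotProduct.eq_1 (fun k => w ⬝ᵥ z ω k), Finset.mul_sum]
    rw [← Finset.sum_add_distrib]
    refine Finset.sum_congr rfl fun k _ => ?_
    simp only [hw_def, hu_def, smul_dotProduct, sub_dotProduct, smul_eq_mul]
    rw [← hqq]
    field_simp
    ring
  change v' ⬝ᵥ _ ≤ 0 ↔ ρ * ((fun k => w ⬝ᵥ z ω k) ⬝ᵥ fun k => w ⬝ᵥ z ω k)
      + s * ((fun k => w ⬝ᵥ z ω k) ⬝ᵥ fun k => u ⬝ᵥ z ω k) ≤ 0
  rw [hterm, dotProduct_sum_vecMulVec_mulVec, ← not_lt, ← not_lt, mul_pos_iff_of_pos_left hr0]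
end

section
/- Let Z ∈ ℝ^{d×r} have i.i.d. N(0, σ_M²) entries, let U ∈ ℝ^{d×s} have orthonormal columns with s < d, and let U_⊥ ∈ ℝ^{d×(d−s)} have orthonormal columns spanning the orthogonal complement of the column space of U. Set G := Uᵀ Z, W := U_⊥ᵀ Z, H := rowspan(G), and let P_H^⊥ be the orthogonal projector of ℝ^r onto H^⊥. Then: (i) Z P_H^⊥ = U_⊥ W P_H^⊥ (deterministically); (ii) conditionally on G, setting p := rank(G) and letting Q_⊥ ∈ ℝ^{r×(r−p)} be a measurable choice of orthonormal basis matrix of H^⊥, the matrix W Q_⊥ ∈ ℝ^{(d−s)×(r−p)} has i.i.d. N(0, σ_M²) entries, and M_⊥ := (Z P_H^⊥)(Z P_H^⊥)ᵀ = U_⊥ (W Q_⊥)(W Q_⊥)ᵀ U_⊥ᵀ. In particular, conditionally on G, M_⊥ has the same distribution as U_⊥ W̃ W̃ᵀ U_⊥ᵀ where W̃ ∈ ℝ^{(d−s)×(r−p)} has i.i.d. N(0, σ_M²) entries. -/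
open MeasureTheory ProbabilityTheory Matrix

section Gaussian

/-- The characteristic function of a matrix with i.i.d. centered Gaussian entries. -/
lemma charFunDual_pi_pi_gaussianReal {ι κ : Type*} [Fintype ι] [Fintype κ] (v : NNReal)
    (L : StrongDual ℝ (ι → κ → ℝ)) (l : Matrix ι κ ℝ)
    (hl : ∀ X : ι → κ → ℝ, L X = (lᵀ * Matrix.of X).trace) :
    charFunDual (Measure.pi fun _ : ι => Measure.pi fun _ : κ => gaussianReal 0 v) L
      = Complex.exp ((-(v * (lᵀ * l).trace / 2) : ℝ)) := by
  classical
  have hsingle : ∀ i j, L (Pi.single i (Pi.single j 1)) = l i j := by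
    intro i j
    rw [hl, Matrix.trace_mul_comm]
    simp [Matrix.trace, Matrix.mul_apply, Pi.single_apply, ite_apply]
  simp_rw [charFunDual_pi, charFunDual_eq_charFun_map_one]
  have hmap : ∀ i j, (gaussianReal 0 v).map
      ((L.comp (.single ℝ (fun _ : ι => κ → ℝ) i)).comp (.single ℝ (fun _ : κ => ℝ) j))
      = gaussianReal 0 (NNReal.mk (l i j ^ 2) (sq_nonneg _) * v) := by
    intro i j
    have : (⇑((L.comp (.single ℝ (fun _ : ι => κ → ℝ) i)).comp (.single ℝ (fun _ : κ => ℝ) j)))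
        = fun x => l i j * x := by
      funext x
      rw [← hsingle i j, mul_comm, ← smul_eq_mul, ← map_smul]
      simp [← Pi.single_smul]
    rw [this, gaussianReal_map_const_mul]
    simp
  simp_rw [hmap, charFun_gaussianReal]
  rw [← Finset.prod_congr rfl fun i _ => Complex.exp_sum _ _, ← Complex.exp_sum]
  congr 1
  rw [Matrix.trace_mul_comm]
  simp [Matrix.trace, Matrix.mul_apply, Finset.mul_sum, Finset.sum_div]
  refine Finset.sum_congr rfl fun i _ => Finset.sum_congr rfl fun j _ => ?_
  ring

/-- Multiplying a matrix with i.i.d. centered Gaussian entries on the left by a matrix with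
orthonormal rows and on the right by a matrix with orthonormal columns preserves the law. -/
lemma map_mul_mul_pi_pi_gaussianReal {ι κ ι' κ' : Type*} [Fintype ι] [Fintype κ]
    [Fintype ι'] [Fintype κ'] [DecidableEq ι'] [DecidableEq κ'] (v : NNReal)
    (A : Matrix ι' ι ℝ) (hA : A * Aᵀ = 1) (B : Matrix κ κ' ℝ) (hB : Bᵀ * B = 1) :
    (Measure.pi fun _ : ι => Measure.pi fun _ : κ => gaussianReal 0 v).map
        (fun X i j => (A * Matrix.of X * B) i j)
      = Measure.pi fun _ : ι' => Measure.pi fun _ : κ' => gaussianReal 0 v := by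
  classical
  let T : (ι → κ → ℝ) →ₗ[ℝ] (ι' → κ' → ℝ) :=
    { toFun := fun X i j => (A * Matrix.of X * B) i j
      map_add' := by
        intro X Y
        ext i j
        simp [← Matrix.of_add_of, Matrix.mul_add, Matrix.add_mul]
      map_smul' := by
        intro c X
        ext i j
        simp [← Matrix.smul_of] }
  let T' := LinearMap.toContinuousLinearMap T
  have hT : (fun (X : ι → κ → ℝ) i j => (A * Matrix.of X * B) i j) = T' := rfl
  have : IsProbabilityMeasure
      ((Measure.pi fun _ : ι => Measure.pi fun _ : κ => gaussianReal 0 v).map T') :=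
    Measure.isProbabilityMeasure_map (by fun_prop)
  rw [hT]
  refine Measure.ext_of_charFunDual ?_
  funext L
  let l : Matrix ι' κ' ℝ := Matrix.of fun i j => L (Pi.single i (Pi.single j 1))
  have hl : ∀ X : ι' → κ' → ℝ, L X = (lᵀ * Matrix.of X).trace := by
    intro X
    have hX : X = ∑ i, ∑ j, X i j • (Pi.single i (Pi.single j 1) : ι' → κ' → ℝ) := by
      ext i j
      simp [Finset.sum_apply, Pi.single_apply, ite_apply]
    conv_lhs => rw [hX]
    rw [Matrix.trace_mul_comm]
    simp [Matrix.trace, Matrix.mul_apply, l]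
  rw [charFunDual_map, charFunDual_pi_pi_gaussianReal v L l hl,
    charFunDual_pi_pi_gaussianReal v (L.comp T') (Aᵀ * l * Bᵀ)]
  · congr 5
    calc ((Aᵀ * l * Bᵀ)ᵀ * (Aᵀ * l * Bᵀ)).trace
        = (B * (lᵀ * (A * Aᵀ) * l * Bᵀ)).trace := by
          simp only [Matrix.transpose_mul, Matrix.transpose_transpose, Matrix.mul_assoc]
      _ = (lᵀ * l * (Bᵀ * B)).trace := by
          rw [hA, Matrix.trace_mul_comm]
          simp only [Matrix.mul_one, Matrix.mul_assoc]
      _ = (lᵀ * l).trace := by rw [hB, Matrix.mul_one]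
  · intro X
    have : (L.comp T') X = (lᵀ * (A * Matrix.of X * B)).trace := hl _
    rw [this]
    simp only [Matrix.transpose_mul, Matrix.transpose_transpose, Matrix.mul_assoc]
    rw [Matrix.trace_mul_comm B]
    simp only [Matrix.mul_assoc]

/-- The two blocks `AᵀX` and `BᵀX` of a matrix `X` with i.i.d. centered Gaussian entries are
independent with i.i.d. entries when the columns of `[A B]` are orthonormal. -/
lemma map_transpose_mul_prod_pi_pi_gaussianReal {ι κ α β : Type*} [Fintype ι] [Fintype κ]
    [Fintype α] [Fintype β] [DecidableEq α] [DecidableEq β] (v : NNReal)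
    (A : Matrix ι α ℝ) (hA : Aᵀ * A = 1) (B : Matrix ι β ℝ) (hB : Bᵀ * B = 1)
    (hAB : Aᵀ * B = 0) :
    (Measure.pi fun _ : ι => Measure.pi fun _ : κ => gaussianReal 0 v).map
        (fun X => ((Aᵀ * Matrix.of X : α → κ → ℝ), (Bᵀ * Matrix.of X : β → κ → ℝ)))
      = (Measure.pi fun _ : α => Measure.pi fun _ : κ => gaussianReal 0 v).prod
        (Measure.pi fun _ : β => Measure.pi fun _ : κ => gaussianReal 0 v) := by
  classical
  have hBA : Bᵀ * A = 0 := by simpa using congrArg Matrix.transpose hAB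
  have hrows : Matrix.fromRows Aᵀ Bᵀ * (Matrix.fromRows Aᵀ Bᵀ)ᵀ = 1 := by
    rw [Matrix.transpose_fromRows, Matrix.fromRows_mul_fromCols]
    simp [hA, hB, hAB, hBA]
  have h1 := map_mul_mul_pi_pi_gaussianReal v (Matrix.fromRows Aᵀ Bᵀ) hrows
    (1 : Matrix κ κ ℝ) (by simp)
  have h2 := (measurePreserving_sumPiEquivProdPi (X := fun _ : α ⊕ β => κ → ℝ)
    (fun _ => Measure.pi fun _ : κ => gaussianReal 0 v)).map_eq
  rw [← h2, ← h1, Measure.map_map (MeasurableEquiv.measurable _)]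
  · congr 1
    funext X
    simp only [Matrix.mul_one]
    rfl
  · refine measurable_pi_lambda _ fun i => measurable_pi_lambda _ fun j => ?_
    simp only [Matrix.mul_apply, Matrix.of_apply]
    fun_prop

end Gaussian

section CondDistrib

lemma MeasureTheory.Measure.restrict_compProd_eq_restrict_prod_univ {α β : Type*}
    {mα : MeasurableSpace α} {mβ : MeasurableSpace β} (μ : Measure α) [SFinite μ]
    (κ : Kernel α β) [IsSFiniteKernel κ] {s : Set α} (hs : MeasurableSet s) :
    (μ.restrict s) ⊗ₘ κ = (μ ⊗ₘ κ).restrict (s ×ˢ Set.univ) := by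
  ext t ht
  rw [Measure.restrict_apply ht, Measure.compProd_apply ht,
    Measure.compProd_apply (ht.inter (hs.prod .univ)), ← lintegral_indicator hs]
  congr with a
  by_cases ha : a ∈ s <;> simp [ha, Set.preimage_inter]

/-- If `W` is independent of `X` with law `ν` and `Y = f (X, W)` on the event `X ∈ s`, then on that
event the conditional law of `Y` given `X` is the image of `ν` under `f (X, ·)`. -/
lemma condDistrib_ae_eq_map_of_eq_on {Ω α β γ : Type*} {mΩ : MeasurableSpace Ω}
    {mα : MeasurableSpace α} {mβ : MeasurableSpace β} {mγ : MeasurableSpace γ}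
    [MeasurableSpace.CountableOrCountablyGenerated α γ]
    [StandardBorelSpace γ] [Nonempty γ] {μ : Measure Ω} [IsFiniteMeasure μ]
    {X : Ω → α} {W : Ω → β} {Y : Ω → γ} (hX : Measurable X) (hW : Measurable W)
    (hY : Measurable Y) {ν : Measure β} [IsProbabilityMeasure ν]
    (hXW : μ.map (fun ω => (X ω, W ω)) = (μ.map X).prod ν)
    {f : α × β → γ} (hf : Measurable f) {s : Set α} (hs : MeasurableSet s)
    (hYf : ∀ ω, X ω ∈ s → Y ω = f (X ω, W ω)) :
    ∀ᵐ ω ∂μ, X ω ∈ s → condDistrib Y X μ (X ω) = ν.map (fun w => f (X ω, w)) := by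
  let κ : Kernel α γ := (Kernel.id ×ₖ Kernel.const α ν).map f
  have hκ : ∀ a, κ a = ν.map (fun w => f (a, w)) := by
    intro a
    rw [Kernel.map_apply _ hf, Kernel.prod_apply, Kernel.id_apply, Kernel.const_apply,
      Measure.dirac_prod, Measure.map_map hf (by fun_prop)]
    rfl
  have : IsMarkovKernel κ := Kernel.IsMarkovKernel.map _ hf
  have hκX : (μ.map X) ⊗ₘ κ = μ.map (fun ω => (X ω, f (X ω, W ω))) := by
    have : (fun ω => (X ω, f (X ω, W ω)))
        = (fun p : α × β => (p.1, f p)) ∘ fun ω => (X ω, W ω) := rfl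
    rw [this, ← Measure.map_map (by fun_prop) (by fun_prop), hXW]
    ext t ht
    rw [Measure.compProd_apply ht, Measure.map_apply (by fun_prop) ht,
      Measure.prod_apply ((measurable_fst.prodMk hf) ht)]
    congr with a
    rw [hκ, Measure.map_apply (by fun_prop) (measurable_prodMk_left ht)]
    rfl
  have hst : MeasurableSet (s ×ˢ (Set.univ : Set γ)) := hs.prod .univ
  have key : ((μ.map X).restrict s) ⊗ₘ condDistrib Y X μ = ((μ.map X).restrict s) ⊗ₘ κ := by
    rw [Measure.restrict_compProd_eq_restrict_prod_univ _ _ hs,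
      Measure.restrict_compProd_eq_restrict_prod_univ _ _ hs, hκX,
      compProd_map_condDistrib hY.aemeasurable,
      Measure.restrict_map (by fun_prop) hst, Measure.restrict_map (by fun_prop) hst]
    have hpre : ∀ g : Ω → γ, (fun ω => (X ω, g ω)) ⁻¹' (s ×ˢ Set.univ) = X ⁻¹' s := by
      intro g; ext; simp
    rw [hpre, hpre fun ω => f (X ω, W ω)]
    refine Measure.map_congr ?_
    filter_upwards [ae_restrict_mem (hX hs)] with ω hω
    rw [hYf ω hω]
  have hae := (ae_restrict_iff' hs).1 (Kernel.ae_eq_of_compProd_eq key)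
  filter_upwards [ae_of_ae_map hX.aemeasurable hae] with ω hω hmem
  rw [hω hmem, hκ]

end CondDistrib

section Measurability

lemma measurable_matrix_mul {α l m n : Type*} [Fintype m] {mα : MeasurableSpace α}
    {A : α → Matrix l m ℝ} {B : α → Matrix m n ℝ}
    (hA : Measurable fun x i j => A x i j) (hB : Measurable fun x i j => B x i j) :
    Measurable fun x i j => (A x * B x) i j := by
  refine measurable_pi_lambda _ fun i => measurable_pi_lambda _ fun j => ?_
  simp only [Matrix.mul_apply]
  refine Finset.measurable_sum _ fun k _ => Measurable.mul ?_ ?_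
  · exact (measurable_pi_apply k).comp ((measurable_pi_apply i).comp hA)
  · exact (measurable_pi_apply j).comp ((measurable_pi_apply k).comp hB)

lemma measurable_matrix_transpose {α m n : Type*} {mα : MeasurableSpace α}
    {A : α → Matrix m n ℝ} (hA : Measurable fun x i j => A x i j) :
    Measurable fun x i j => (A x)ᵀ i j := by
  refine measurable_pi_lambda _ fun i => measurable_pi_lambda _ fun j => ?_
  exact (measurable_pi_apply i).comp ((measurable_pi_apply j).comp hA)

end Measurability

section LinearAlgebra

lemma mul_transpose_add_mul_transpose_eq_one {d s : ℕ} (hs : s ≤ d)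
    {U : Matrix (Fin d) (Fin s) ℝ} (hU : Uᵀ * U = 1)
    {V : Matrix (Fin d) (Fin (d - s)) ℝ} (hV : Vᵀ * V = 1) (hUV : Uᵀ * V = 0) :
    U * Uᵀ + V * Vᵀ = 1 := by
  have hVU : Vᵀ * U = 0 := by simpa using congrArg Matrix.transpose hUV
  rw [← Matrix.fromCols_mul_fromRows, Matrix.mul_eq_one_comm_of_card_eq,
    Matrix.fromRows_mul_fromCols, hU, hV, hUV, hVU, Matrix.fromBlocks_one]
  simp [Nat.add_sub_of_le hs]

/-- The projector onto the row space of `g` fixes the rows of `g`. -/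
lemma mul_eq_self_of_range_eq_span_rows {s r : ℕ} {g : Matrix (Fin s) (Fin r) ℝ}
    {P : Matrix (Fin r) (Fin r) ℝ} (hsymm : Pᵀ = P) (hidem : P * P = P)
    (hrange : LinearMap.range (Matrix.toLin' P)
      = Submodule.span ℝ (Set.range fun i : Fin s => g i)) :
    g * P = g := by
  ext i j
  have hmem : g i ∈ LinearMap.range (Matrix.toLin' P) :=
    hrange ▸ Submodule.subset_span ⟨i, rfl⟩
  obtain ⟨x, hx⟩ := hmem
  have hPg : P *ᵥ g i = g i := by
    rw [← hx, Matrix.toLin'_apply, Matrix.mulVec_mulVec, hidem]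
  rw [Matrix.mul_apply_eq_vecMul, ← hsymm, Matrix.vecMul_transpose]
  exact congrFun hPg j

/-- A matrix whose columns are orthogonal to the rows of `g` is killed by the projector onto the
row space of `g`. -/
lemma transpose_mul_eq_zero_of_range_eq_span_rows {s r q : ℕ} {g : Matrix (Fin s) (Fin r) ℝ}
    {P : Matrix (Fin r) (Fin r) ℝ} {Q : Matrix (Fin r) (Fin q) ℝ}
    (hrange : LinearMap.range (Matrix.toLin' P)
      = Submodule.span ℝ (Set.range fun i : Fin s => g i)) (hgQ : g * Q = 0) :
    Qᵀ * P = 0 := by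
  have hle : Submodule.span ℝ (Set.range fun i : Fin s => g i)
      ≤ LinearMap.ker (Matrix.toLin' Qᵀ) := by
    rw [Submodule.span_le]
    rintro _ ⟨i, rfl⟩
    have : Qᵀ *ᵥ g i = 0 := by
      rw [Matrix.mulVec_transpose]
      funext j
      have := congrFun (congrFun hgQ i) j
      rwa [Matrix.mul_apply_eq_vecMul] at this
    simpa using this
  rw [← hrange] at hle
  apply Matrix.toLin'.injective
  rw [Matrix.toLin'_mul, map_zero]
  exact LinearMap.range_le_ker_iff.1 hle

/-- The matrices `g` for which `Q g` is certified to be an orthonormal basis matrix of `ker g` by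
polynomial conditions on the entries. -/
def orthonormalKernelBasisSet {s r q : ℕ}
    (Q : (Fin s → Fin r → ℝ) → Matrix (Fin r) (Fin q) ℝ) : Set (Fin s → Fin r → ℝ) :=
  {g | Matrix.of g * Q g = 0 ∧ (Q g)ᵀ * Q g = 1 ∧
    ((Matrix.of g)ᵀ * Matrix.of g + Q g * (Q g)ᵀ).det ≠ 0}

lemma measurableSet_orthonormalKernelBasisSet {s r q : ℕ}
    {Q : (Fin s → Fin r → ℝ) → Matrix (Fin r) (Fin q) ℝ}
    (hQ : Measurable fun g i j => Q g i j) :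
    MeasurableSet (orthonormalKernelBasisSet Q) := by
  have hof : Measurable fun (g : Fin s → Fin r → ℝ) i j => Matrix.of g i j := measurable_id
  have h1 : Measurable fun (g : Fin s → Fin r → ℝ) i j => (Matrix.of g * Q g) i j :=
    measurable_matrix_mul hof hQ
  have h2 : Measurable fun (g : Fin s → Fin r → ℝ) i j => ((Q g)ᵀ * Q g) i j :=
    measurable_matrix_mul (measurable_matrix_transpose hQ) hQ
  have h3 : Measurable fun (g : Fin s → Fin r → ℝ) i j =>
      ((Matrix.of g)ᵀ * Matrix.of g + Q g * (Q g)ᵀ) i j :=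
    (measurable_matrix_mul (measurable_matrix_transpose hof) hof).add
      (measurable_matrix_mul hQ (measurable_matrix_transpose hQ))
  have hdet : Measurable fun (A : Fin r → Fin r → ℝ) => (Matrix.of A).det :=
    have : Continuous fun (A : Fin r → Fin r → ℝ) => (Matrix.of A).det :=
      Continuous.matrix_det continuous_id
    this.measurable
  refine MeasurableSet.inter ?_ (MeasurableSet.inter ?_ ?_)
  · exact h1 (measurableSet_singleton (0 : Fin s → Fin q → ℝ))
  · exact h2 (measurableSet_singleton (fun i j : Fin q => (1 : Matrix (Fin q) (Fin q) ℝ) i j))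
  · exact (hdet.comp h3) (measurableSet_singleton (0 : ℝ)).compl

lemma mem_orthonormalKernelBasisSet {s r q : ℕ}
    {Q : (Fin s → Fin r → ℝ) → Matrix (Fin r) (Fin q) ℝ} {g : Fin s → Fin r → ℝ}
    (horth : (Q g)ᵀ * Q g = 1)
    (hspan : LinearMap.range (Matrix.toLin' (Q g)) = LinearMap.ker (Matrix.toLin' (Matrix.of g))) :
    g ∈ orthonormalKernelBasisSet Q := by
  refine ⟨?_, horth, fun hdet => ?_⟩
  · apply Matrix.toLin'.injective
    rw [Matrix.toLin'_mul, map_zero]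
    exact LinearMap.range_le_ker_iff.1 hspan.le
  · obtain ⟨x, hx0, hx⟩ := Matrix.exists_mulVec_eq_zero_iff.2 hdet
    have hsum : (Matrix.of g *ᵥ x) ⬝ᵥ (Matrix.of g *ᵥ x) + ((Q g)ᵀ *ᵥ x) ⬝ᵥ ((Q g)ᵀ *ᵥ x) = 0 := by
      have := congrArg (fun y => x ⬝ᵥ y) hx
      simp only [Matrix.add_mulVec, dotProduct_add, dotProduct_zero, ← Matrix.mulVec_mulVec,
        Matrix.dotProduct_mulVec x, Matrix.vecMul_transpose] at this
      rwa [← Matrix.mulVec_transpose] at this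
    have hn1 : 0 ≤ (Matrix.of g *ᵥ x) ⬝ᵥ (Matrix.of g *ᵥ x) :=
      Finset.sum_nonneg fun i _ => mul_self_nonneg _
    have hn2 : 0 ≤ ((Q g)ᵀ *ᵥ x) ⬝ᵥ ((Q g)ᵀ *ᵥ x) :=
      Finset.sum_nonneg fun i _ => mul_self_nonneg _
    have hgx : Matrix.of g *ᵥ x = 0 := dotProduct_self_eq_zero.1 (by linarith)
    have hQx : (Q g)ᵀ *ᵥ x = 0 := dotProduct_self_eq_zero.1 (by linarith)
    have hmem : x ∈ LinearMap.range (Matrix.toLin' (Q g)) := by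
      rw [hspan]
      simpa using hgx
    obtain ⟨y, rfl⟩ := hmem
    apply hx0
    have hy : y = 0 := by
      rwa [Matrix.toLin'_apply, Matrix.mulVec_mulVec, horth, Matrix.one_mulVec] at hQx
    rw [hy, map_zero]

lemma mul_transpose_eq_one_sub_of_mem_orthonormalKernelBasisSet {s r q : ℕ}
    {Q : (Fin s → Fin r → ℝ) → Matrix (Fin r) (Fin q) ℝ} {g : Fin s → Fin r → ℝ}
    (hg : g ∈ orthonormalKernelBasisSet Q)
    {P : Matrix (Fin r) (Fin r) ℝ} (hsymm : Pᵀ = P) (hidem : P * P = P)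
    (hrange : LinearMap.range (Matrix.toLin' P)
      = Submodule.span ℝ (Set.range fun i : Fin s => g i)) :
    Q g * (Q g)ᵀ = 1 - P := by
  obtain ⟨hgQ, horth, hdet⟩ := hg
  have hgP : Matrix.of g * P = Matrix.of g := mul_eq_self_of_range_eq_span_rows hsymm hidem hrange
  have hQP : (Q g)ᵀ * P = 0 :=
    transpose_mul_eq_zero_of_range_eq_span_rows (g := Matrix.of g) hrange hgQ
  have hgR : Matrix.of g * (1 - P - Q g * (Q g)ᵀ) = 0 := by
    rw [Matrix.mul_sub, Matrix.mul_sub, ← Matrix.mul_assoc, hgP, hgQ]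
    simp
  have hQR : (Q g)ᵀ * (1 - P - Q g * (Q g)ᵀ) = 0 := by
    rw [Matrix.mul_sub, Matrix.mul_sub, ← Matrix.mul_assoc, hQP, horth]
    simp
  have hR : ((Matrix.of g)ᵀ * Matrix.of g + Q g * (Q g)ᵀ) * (1 - P - Q g * (Q g)ᵀ) = 0 := by
    rw [Matrix.add_mul, Matrix.mul_assoc, Matrix.mul_assoc, hgR, hQR]
    simp
  have hunit := (Matrix.isUnit_iff_isUnit_det _).2 (isUnit_iff_ne_zero.2 hdet)
  exact (sub_eq_zero.1 (hunit.mul_right_eq_zero.1 hR)).symm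

end LinearAlgebra

/-- structure of the residual block.  With `Z` i.i.d. `N(0, σ_M²)`,
`G = Uᵀ Z`, `W = U⊥ᵀ Z`, `H = rowspan(G)`, `P` the projector onto `H` (so `I − P` projects
onto `H^⊥`): (i) `Z (I − P) = U⊥ W (I − P)` deterministically; (ii) conditionally on `G`,
on the event `rank G = p₀`, for a measurable choice `Qsel g` of orthonormal basis matrix of
`H^⊥`, the matrix `W · Qsel(G)` has i.i.d. `N(0, σ_M²)` entries and
`M⊥ = U⊥ (W Qsel(G)) (W Qsel(G))ᵀ U⊥ᵀ`; in particular, conditionally on `G`, `M⊥` is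
distributed as `U⊥ W̃ W̃ᵀ U⊥ᵀ` for `W̃` an i.i.d. `N(0, σ_M²)` matrix of size
`(d−s) × (r−p₀)`. -/
theorem stmt9
    {Ω : Type} [MeasureSpace Ω] [IsProbabilityMeasure (ℙ : Measure Ω)]
    (d r s : ℕ) (hs : s < d) (σM : NNReal) (hσM : 0 < σM)
    (Z : Ω → Fin d → Fin r → ℝ) (hZmeas : Measurable Z)
    (hZ : Measure.map Z ℙ
      = Measure.pi fun _ : Fin d => Measure.pi fun _ : Fin r => gaussianReal 0 (σM ^ 2))
    (U : Matrix (Fin d) (Fin s) ℝ) (hU : Uᵀ * U = 1)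
    (Uperp : Matrix (Fin d) (Fin (d - s)) ℝ) (hUperp : Uperpᵀ * Uperp = 1)
    (hUUperp : Uᵀ * Uperp = 0)
    (G : Ω → Fin s → Fin r → ℝ) (hG : G = fun ω => Uᵀ * Matrix.of (Z ω))
    (W : Ω → Fin (d - s) → Fin r → ℝ) (hW : W = fun ω => Uperpᵀ * Matrix.of (Z ω))
    (P : Ω → Matrix (Fin r) (Fin r) ℝ)
    (hPmeas : Measurable fun ω i j => P ω i j)
    (hPsymm : ∀ ω, (P ω)ᵀ = P ω) (hPidem : ∀ ω, P ω * P ω = P ω)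
    (hPrange : ∀ ω, LinearMap.range (Matrix.toLin' (P ω))
      = Submodule.span ℝ (Set.range fun i : Fin s => G ω i))
    (Mperp : Ω → Fin d → Fin d → ℝ)
    (hMperp : Mperp = fun ω =>
      (Matrix.of (Z ω) * (1 - P ω)) * (Matrix.of (Z ω) * (1 - P ω))ᵀ)
    (p₀ : ℕ) (hp₀ : p₀ ≤ r)
    (Qsel : (Fin s → Fin r → ℝ) → Matrix (Fin r) (Fin (r - p₀)) ℝ)
    (hQmeas : Measurable fun g i j => Qsel g i j)
    (hQorth : ∀ g : Fin s → Fin r → ℝ, (Matrix.of g).rank = p₀ →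
      (Qsel g)ᵀ * Qsel g = 1)
    (hQspan : ∀ g : Fin s → Fin r → ℝ, (Matrix.of g).rank = p₀ →
      LinearMap.range (Matrix.toLin' (Qsel g))
        = LinearMap.ker (Matrix.toLin' (Matrix.of g))) :
    -- (i) deterministic identity
    (∀ ω, Matrix.of (Z ω) * (1 - P ω) = Uperp * Matrix.of (W ω) * (1 - P ω)) ∧
    -- (ii) algebraic identity on the event `rank G = p₀`
    (∀ ω, (Matrix.of (G ω)).rank = p₀ →
      Matrix.of (Mperp ω)
        = Uperp * (Matrix.of (W ω) * Qsel (G ω)) * (Matrix.of (W ω) * Qsel (G ω))ᵀ * Uperpᵀ) ∧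
    -- (ii) conditionally on `G`, `W · Qsel(G)` has i.i.d. `N(0, σ_M²)` entries
    (∀ᵐ ω ∂ℙ, (Matrix.of (G ω)).rank = p₀ →
      condDistrib (fun ω' (i : Fin (d - s)) (j : Fin (r - p₀)) =>
          (Matrix.of (W ω') * Qsel (G ω')) i j) G ℙ (G ω)
        = Measure.pi fun _ : Fin (d - s) => Measure.pi fun _ : Fin (r - p₀) =>
            gaussianReal 0 (σM ^ 2)) ∧
    -- in particular: conditional law of `M⊥` given `G`
    (∀ᵐ ω ∂ℙ, (Matrix.of (G ω)).rank = p₀ →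
      condDistrib Mperp G ℙ (G ω)
        = Measure.map
            (fun (w : Fin (d - s) → Fin (r - p₀) → ℝ) (i j : Fin d) =>
              (Uperp * Matrix.of w * (Matrix.of w)ᵀ * Uperpᵀ) i j)
            (Measure.pi fun _ : Fin (d - s) => Measure.pi fun _ : Fin (r - p₀) =>
              gaussianReal 0 (σM ^ 2))) := by
  have hsum := mul_transpose_add_mul_transpose_eq_one hs.le hU hUperp hUUperp
  have hGω : ∀ ω, Matrix.of (G ω) = Uᵀ * Matrix.of (Z ω) := fun ω => congrFun hG ω
  have hWω : ∀ ω, Matrix.of (W ω) = Uperpᵀ * Matrix.of (Z ω) := fun ω => congrFun hW ω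
  have hMω : ∀ ω, Matrix.of (Mperp ω)
      = (Matrix.of (Z ω) * (1 - P ω)) * (Matrix.of (Z ω) * (1 - P ω))ᵀ := fun ω => congrFun hMperp ω
  have hresidual : ∀ ω,
      Matrix.of (Z ω) * (1 - P ω) = Uperp * Matrix.of (W ω) * (1 - P ω) := by
    intro ω
    have hGP : Uᵀ * (Matrix.of (Z ω) * (1 - P ω)) = 0 := by
      rw [← Matrix.mul_assoc, ← hGω, Matrix.mul_sub, Matrix.mul_one,
        mul_eq_self_of_range_eq_span_rows (g := Matrix.of (G ω)) (hPsymm ω) (hPidem ω) (hPrange ω),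
        sub_self]
    calc Matrix.of (Z ω) * (1 - P ω)
        = (U * Uᵀ + Uperp * Uperpᵀ) * (Matrix.of (Z ω) * (1 - P ω)) := by
          rw [hsum, Matrix.one_mul]
      _ = Uperp * Matrix.of (W ω) * (1 - P ω) := by
          rw [Matrix.add_mul, Matrix.mul_assoc U, hGP, Matrix.mul_zero, zero_add, hWω]
          simp only [Matrix.mul_assoc]
  have hfactor : ∀ ω, G ω ∈ orthonormalKernelBasisSet Qsel → Matrix.of (Mperp ω)
      = Uperp * (Matrix.of (W ω) * Qsel (G ω)) * (Matrix.of (W ω) * Qsel (G ω))ᵀ * Uperpᵀ := by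
    intro ω hω
    have hQQ := mul_transpose_eq_one_sub_of_mem_orthonormalKernelBasisSet hω (hPsymm ω) (hPidem ω)
      (hPrange ω)
    rw [hMω, hresidual, ← hQQ]
    have horth := hω.2.1
    calc Uperp * Matrix.of (W ω) * (Qsel (G ω) * (Qsel (G ω))ᵀ)
          * (Uperp * Matrix.of (W ω) * (Qsel (G ω) * (Qsel (G ω))ᵀ))ᵀ
        = Uperp * Matrix.of (W ω) * Qsel (G ω) * ((Qsel (G ω))ᵀ * Qsel (G ω))
          * (Qsel (G ω))ᵀ * (Matrix.of (W ω))ᵀ * Uperpᵀ := by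
          simp only [Matrix.transpose_mul, Matrix.transpose_transpose, Matrix.mul_assoc]
      _ = _ := by
          rw [horth]
          simp only [Matrix.transpose_mul, Matrix.mul_one, Matrix.mul_assoc]
  have hmem : ∀ g : Fin s → Fin r → ℝ, (Matrix.of g).rank = p₀ →
      g ∈ orthonormalKernelBasisSet Qsel := fun g hg =>
    mem_orthonormalKernelBasisSet (hQorth g hg) (hQspan g hg)
  have hset := measurableSet_orthonormalKernelBasisSet hQmeas
  have hGmeas : Measurable G := by
    rw [hG]
    exact measurable_matrix_mul (A := fun _ => Uᵀ) measurable_const hZmeas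
  have hWmeas : Measurable W := by
    rw [hW]
    exact measurable_matrix_mul (A := fun _ => Uperpᵀ) measurable_const hZmeas
  have hjoint : (Measure.map (fun ω => (G ω, W ω)) ℙ)
      = (Measure.pi fun _ : Fin s => Measure.pi fun _ : Fin r => gaussianReal 0 (σM ^ 2)).prod
        (Measure.pi fun _ : Fin (d - s) => Measure.pi fun _ : Fin r =>
          gaussianReal 0 (σM ^ 2)) := by
    rw [← map_transpose_mul_prod_pi_pi_gaussianReal _ U hU Uperp hUperp hUUperp, ← hZ,
      Measure.map_map _ hZmeas]
    · rw [hG, hW]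
      rfl
    · exact (measurable_matrix_mul (A := fun _ => Uᵀ) measurable_const measurable_id).prodMk
        (measurable_matrix_mul (A := fun _ => Uperpᵀ) measurable_const measurable_id)
  have hGlaw : Measure.map G ℙ
      = Measure.pi fun _ : Fin s => Measure.pi fun _ : Fin r => gaussianReal 0 (σM ^ 2) := by
    have := congrArg Measure.fst hjoint
    rwa [Measure.fst_map_prodMk hWmeas, Measure.fst_prod] at this
  rw [← hGlaw] at hjoint
  have hWQmeas : Measurable fun (p : (Fin s → Fin r → ℝ) × (Fin (d - s) → Fin r → ℝ)) i j =>
      (Matrix.of p.2 * Qsel p.1) i j :=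
    measurable_matrix_mul measurable_snd (hQmeas.comp measurable_fst)
  have hWQlaw : ∀ g ∈ orthonormalKernelBasisSet Qsel,
      (Measure.pi fun _ : Fin (d - s) => Measure.pi fun _ : Fin r =>
        gaussianReal 0 (σM ^ 2)).map (fun w i j => (Matrix.of w * Qsel g) i j)
      = Measure.pi fun _ : Fin (d - s) => Measure.pi fun _ : Fin (r - p₀) =>
        gaussianReal 0 (σM ^ 2) := by
    intro g hg
    have := map_mul_mul_pi_pi_gaussianReal (σM ^ 2) (1 : Matrix (Fin (d - s)) (Fin (d - s)) ℝ)
      (by simp) (Qsel g) hg.2.1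
    simpa only [Matrix.one_mul] using this
  have hgram : Measurable fun (w : Fin (d - s) → Fin (r - p₀) → ℝ) (i j : Fin d) =>
      (Uperp * Matrix.of w * (Matrix.of w)ᵀ * Uperpᵀ) i j :=
    measurable_matrix_mul
      (measurable_matrix_mul
        (measurable_matrix_mul (A := fun _ => Uperp) measurable_const measurable_id)
        (measurable_matrix_transpose measurable_id))
      measurable_const
  have hMmeas : Measurable Mperp := by
    have hone : Measurable fun ω i j => (1 - P ω : Matrix (Fin r) (Fin r) ℝ) i j :=
      Measurable.sub (f := fun _ i j => (1 : Matrix (Fin r) (Fin r) ℝ) i j)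
        measurable_const hPmeas
    have hZP : Measurable fun ω i j =>
        (Matrix.of (Z ω) * (1 - P ω) : Matrix (Fin d) (Fin r) ℝ) i j :=
      measurable_matrix_mul (A := fun ω => Matrix.of (Z ω)) hZmeas hone
    rw [hMperp]
    exact measurable_matrix_mul hZP (measurable_matrix_transpose hZP)
  refine ⟨hresidual, fun ω hω => hfactor ω (hmem _ hω), ?_, ?_⟩
  · have h := condDistrib_ae_eq_map_of_eq_on hGmeas hWmeas
      (hWQmeas.comp (hGmeas.prodMk hWmeas)) hjoint hWQmeas hset (fun _ _ => rfl)
    filter_upwards [h] with ω hω hrank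
    exact (hω (hmem _ hrank)).trans (hWQlaw _ (hmem _ hrank))
  · have h := condDistrib_ae_eq_map_of_eq_on hGmeas hWmeas hMmeas hjoint (hgram.comp hWQmeas) hset
      (fun ω hω => hfactor ω hω)
    filter_upwards [h] with ω hω hrank
    rw [hω (hmem _ hrank), ← hWQlaw _ (hmem _ hrank)]
    exact (Measure.map_map hgram (hWQmeas.comp measurable_prodMk_left)).symm
end

section
/- Let 1 ≤ r ≤ d − 1, let Z ∈ ℝ^{d×r} have i.i.d. N(0,1) entries, and let P_M denote the orthogonal projector onto the column space of Z. Let ΔV ∈ ℝ^{d×n} be a fixed nonzero matrix of rank s ≥ 1. Then for every α ∈ (0,1), ℙ( ‖P_M ΔV‖_F² > α·‖ΔV‖_F² ) ≤ s·( 1 − I_α(r/2, (d−r)/2) ), where I_α(a,b) denotes the regularized incomplete beta function, i.e., the CDF of the Beta(a,b) distribution evaluated at α. -/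
open MeasureTheory ProbabilityTheory Matrix

/-- Regularized incomplete beta function `I_x(a,b)`: the CDF of the `Beta(a,b)`
distribution at `x`. -/
noncomputable def regIncBeta (a b x : ℝ) : ℝ :=
  (∫ t in (0 : ℝ)..x, t ^ (a - 1) * (1 - t) ^ (b - 1))
    / ∫ t in (0 : ℝ)..1, t ^ (a - 1) * (1 - t) ^ (b - 1)

open scoped ENNReal Finset

theorem lintegral_fun_norm_addHaar {E : Type*} [NormedAddCommGroup E] [NormedSpace ℝ E]
    [MeasurableSpace E] [Nontrivial E] (μ : Measure E) [FiniteDimensional ℝ E] [BorelSpace E]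
    [μ.IsAddHaarMeasure] {f : ℝ → ℝ≥0∞} (hf : Measurable f) :
    ∫⁻ x, f ‖x‖ ∂μ = μ.toSphere Set.univ *
      ∫⁻ y in Set.Ioi (0 : ℝ), ENNReal.ofReal (y ^ (Module.finrank ℝ E - 1)) * f y := by
  calc
    ∫⁻ x, f ‖x‖ ∂μ = ∫⁻ x : ({(0)}ᶜ : Set E), f ‖x.1‖ ∂(μ.comap (↑)) := by
      rw [lintegral_subtype_comap (measurableSet_singleton _).compl fun x ↦ f ‖x‖,
        restrict_compl_singleton]
    _ = ∫⁻ x, f x.2 ∂μ.toSphere.prod (.volumeIoiPow (Module.finrank ℝ E - 1)) := by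
      simpa using μ.measurePreserving_homeomorphUnitSphereProd.lintegral_comp_emb
        (Homeomorph.measurableEmbedding _) (f ∘ Subtype.val ∘ Prod.snd)
    _ = μ.toSphere Set.univ *
        ∫⁻ x : Set.Ioi (0 : ℝ), f x ∂.volumeIoiPow (Module.finrank ℝ E - 1) := by
      rw [lintegral_prod _ (by fun_prop)]
      simp only [lintegral_const]
      rw [mul_comm]
    _ = _ := by
      rw [Measure.volumeIoiPow, lintegral_withDensity_eq_lintegral_mul _ (by fun_prop)
        (by fun_prop)]
      congr 1
      exact lintegral_subtype_comap measurableSet_Ioi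
        fun y : ℝ ↦ ENNReal.ofReal (y ^ (Module.finrank ℝ E - 1)) * f y

theorem stdGaussian_eq_withDensity (E : Type*) [NormedAddCommGroup E] [InnerProductSpace ℝ E]
    [FiniteDimensional ℝ E] [MeasurableSpace E] [BorelSpace E] :
    ∃ c : ℝ≥0∞, stdGaussian E =
      c • (volume : Measure E).withDensity fun x ↦ ENNReal.ofReal (Real.exp (-‖x‖ ^ 2 / 2)) := by
  set I : ℝ := ∫ x : E, Real.exp (-‖x‖ ^ 2 / 2) with hI
  have key : ∀ t : E, ∫ x : E, Complex.exp (-(1 / 2 : ℂ) * ‖x‖ ^ 2 + Complex.I * inner ℝ t x) =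
      (Real.pi / (1 / 2 : ℂ)) ^ (Module.finrank ℝ E / 2 : ℂ) *
        Complex.exp (Complex.I ^ 2 * ‖t‖ ^ 2 / (4 * (1 / 2))) := fun t ↦
    GaussianFourier.integral_cexp_neg_mul_sq_norm_add (by norm_num) Complex.I t
  have hIC : (I : ℂ) = (Real.pi / (1 / 2 : ℂ)) ^ (Module.finrank ℝ E / 2 : ℂ) := by
    have := key 0
    simp only [inner_zero_left, norm_zero] at this
    rw [hI, ← integral_complex_ofReal]
    simp only [Complex.ofReal_zero, mul_zero, add_zero, ne_eq, OfNat.ofNat_ne_zero,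
      not_false_eq_true, zero_pow, zero_div, Complex.exp_zero, mul_one] at this
    rw [← this]
    congr with x
    push_cast
    ring_nf
  have hI0 : I ≠ 0 := by
    intro h
    rw [h, Complex.ofReal_zero, eq_comm, Complex.cpow_eq_zero_iff] at hIC
    simp [Real.pi_ne_zero] at hIC
  have hIpos : 0 < I := lt_of_le_of_ne (integral_nonneg fun _ ↦ (Real.exp_pos _).le) hI0.symm
  have hint : Integrable (fun x : E ↦ Real.exp (-‖x‖ ^ 2 / 2)) :=
    Integrable.of_integral_ne_zero hI0
  have hfin : IsFiniteMeasure
      ((volume : Measure E).withDensity fun x ↦ ENNReal.ofReal (Real.exp (-‖x‖ ^ 2 / 2))) :=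
    isFiniteMeasure_withDensity_ofReal hint.2
  refine ⟨ENNReal.ofReal I⁻¹, ?_⟩
  have : IsFiniteMeasure (ENNReal.ofReal I⁻¹ • (volume : Measure E).withDensity
      fun x ↦ ENNReal.ofReal (Real.exp (-‖x‖ ^ 2 / 2))) :=
    Measure.smul_finite _ ENNReal.ofReal_ne_top
  apply Measure.ext_of_charFun
  ext t
  rw [charFun_stdGaussian, charFun_apply, integral_smul_measure,
    integral_withDensity_eq_integral_toReal_smul (by fun_prop) (by simp),
    ENNReal.toReal_ofReal (by positivity)]
  have h2 : ∀ x : E, (ENNReal.ofReal (Real.exp (-‖x‖ ^ 2 / 2))).toReal •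
      Complex.exp (inner ℝ x t * Complex.I) =
      Complex.exp (-(1 / 2 : ℂ) * ‖x‖ ^ 2 + Complex.I * inner ℝ t x) := by
    intro x
    rw [ENNReal.toReal_ofReal (Real.exp_pos _).le, Complex.exp_add, Complex.real_smul,
      real_inner_comm]
    push_cast
    ring_nf
  simp_rw [h2]
  rw [key, ← hIC, Complex.real_smul, ← mul_assoc, ← Complex.ofReal_mul, inv_mul_cancel₀ hI0,
    Complex.I_sq]
  push_cast
  ring_nf

theorem lintegral_fun_norm_stdGaussian (E : Type*) [NormedAddCommGroup E] [InnerProductSpace ℝ E]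
    [FiniteDimensional ℝ E] [MeasurableSpace E] [BorelSpace E] [Nontrivial E] :
    ∃ c : ℝ≥0∞, ∀ f : ℝ → ℝ≥0∞, Measurable f → ∫⁻ x, f ‖x‖ ∂stdGaussian E =
      c * ∫⁻ y in Set.Ioi (0 : ℝ),
        ENNReal.ofReal (y ^ (Module.finrank ℝ E - 1) * Real.exp (-y ^ 2 / 2)) * f y := by
  obtain ⟨c, hc⟩ := stdGaussian_eq_withDensity E
  refine ⟨c * (volume : Measure E).toSphere Set.univ, fun f hf ↦ ?_⟩
  rw [hc, lintegral_smul_measure, lintegral_withDensity_eq_lintegral_mul _ (by fun_prop)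
    (by fun_prop), mul_assoc, smul_eq_mul]
  have := lintegral_fun_norm_addHaar (volume : Measure E)
    (f := fun y ↦ ENNReal.ofReal (Real.exp (-y ^ 2 / 2)) * f y) (by fun_prop)
  simp only [Pi.mul_apply]
  rw [this]
  congr 2
  refine setLIntegral_congr_fun measurableSet_Ioi fun y hy ↦ ?_
  have : 0 < y := hy
  rw [ENNReal.ofReal_mul (by positivity), mul_assoc]

theorem lintegral_gaussian_quadrant {r m : ℕ} (hr : 1 ≤ r) (hm : 1 ≤ m) :
    ∃ c : ℝ≥0∞, ∀ G : ℝ → ℝ≥0∞, Measurable G →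
      ∫⁻ s in Set.Ioi (0 : ℝ), ∫⁻ t in Set.Ioi (0 : ℝ),
        ENNReal.ofReal (s ^ (r - 1) * Real.exp (-s ^ 2 / 2)) *
          (ENNReal.ofReal (t ^ (m - 1) * Real.exp (-t ^ 2 / 2)) * G (s ^ 2 / (s ^ 2 + t ^ 2))) =
      c * ∫⁻ w in Set.Ioo (0 : ℝ) 1,
        ENNReal.ofReal (w ^ ((r : ℝ) / 2 - 1) * (1 - w) ^ ((m : ℝ) / 2 - 1)) * G w := by
  refine ⟨(∫⁻ ρ in Set.Ioi (0 : ℝ), ENNReal.ofReal (ρ ^ (r + m - 1) * Real.exp (-ρ ^ 2 / 2))) *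
    ENNReal.ofReal (1 / 2), fun G hG ↦ ?_⟩
  have hπ := Real.pi_pos
  have himg : (fun θ ↦ Real.cos θ ^ 2) '' Set.Ioo 0 (Real.pi / 2) = Set.Ioo 0 1 := by
    ext w
    constructor
    · rintro ⟨θ, ⟨h0, h1⟩, rfl⟩
      have hc : 0 < Real.cos θ := Real.cos_pos_of_mem_Ioo ⟨by linarith, h1⟩
      have hs : 0 < Real.sin θ := Real.sin_pos_of_pos_of_lt_pi h0 (by linarith)
      have := Real.sin_sq_add_cos_sq θ
      constructor
      · positivity
      · simp only; nlinarith
    · rintro ⟨h0, h1⟩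
      refine ⟨Real.arccos √w, ⟨?_, ?_⟩, ?_⟩
      · rw [Real.arccos_pos, Real.sqrt_lt' one_pos]; linarith
      · rw [Real.arccos_lt_pi_div_two]; positivity
      · simp only
        rw [Real.cos_arccos (by linarith [Real.sqrt_nonneg w]) (Real.sqrt_le_one.mpr h1.le),
          Real.sq_sqrt h0.le]
  have hinj : Set.InjOn (fun θ ↦ Real.cos θ ^ 2) (Set.Ioo 0 (Real.pi / 2)) := by
    intro x hx y hy h
    have hx' : 0 < Real.cos x := Real.cos_pos_of_mem_Ioo ⟨by linarith [hx.1], hx.2⟩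
    have hy' : 0 < Real.cos y := Real.cos_pos_of_mem_Ioo ⟨by linarith [hy.1], hy.2⟩
    exact Real.injOn_cos ⟨hx.1.le, by linarith [hx.2]⟩ ⟨hy.1.le, by linarith [hy.2]⟩
      ((sq_eq_sq₀ hx'.le hy'.le).1 h)
  rw [← himg, lintegral_image_eq_lintegral_abs_deriv_mul measurableSet_Ioo
    (f' := fun θ ↦ 2 * Real.cos θ * (-Real.sin θ))
    (fun θ _ ↦ by simpa using ((Real.hasDerivAt_cos θ).fun_pow 2).hasDerivWithinAt) hinj,
    mul_assoc, ← lintegral_const_mul _ (by fun_prop)]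
  have hang : ∀ θ ∈ Set.Ioo 0 (Real.pi / 2), ENNReal.ofReal (1 / 2) *
      (ENNReal.ofReal |2 * Real.cos θ * (-Real.sin θ)| *
        (ENNReal.ofReal ((Real.cos θ ^ 2) ^ ((r : ℝ) / 2 - 1) *
          (1 - Real.cos θ ^ 2) ^ ((m : ℝ) / 2 - 1)) * G (Real.cos θ ^ 2))) =
      ENNReal.ofReal (Real.cos θ ^ (r - 1) * Real.sin θ ^ (m - 1)) * G (Real.cos θ ^ 2) := by
    intro θ ⟨h0, h1⟩
    have hc : 0 < Real.cos θ := Real.cos_pos_of_mem_Ioo ⟨by linarith, h1⟩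
    have hs : 0 < Real.sin θ := Real.sin_pos_of_pos_of_lt_pi h0 (by linarith)
    have hpow : ∀ x : ℝ, 0 < x → ∀ k : ℕ, 1 ≤ k →
        x * (x ^ 2) ^ ((k : ℝ) / 2 - 1) = x ^ (k - 1) := by
      intro x hx k hk
      rw [← Real.rpow_natCast x 2, ← Real.rpow_mul hx.le, ← Real.rpow_natCast]
      nth_rewrite 1 [← Real.rpow_one x]
      rw [← Real.rpow_add hx]
      congr 1
      push_cast [hk]
      ring
    rw [← Real.sin_sq, ← mul_assoc, ← mul_assoc, ← ENNReal.ofReal_mul (by norm_num),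
      ← ENNReal.ofReal_mul (by positivity), ← hpow _ hc r hr, ← hpow _ hs m hm, mul_neg, abs_neg,
      abs_of_pos (by positivity)]
    ring_nf
  rw [setLIntegral_congr_fun measurableSet_Ioo hang]
  set F : ℝ × ℝ → ℝ≥0∞ := fun p ↦ ENNReal.ofReal (p.1 ^ (r - 1) * Real.exp (-p.1 ^ 2 / 2)) *
    (ENNReal.ofReal (p.2 ^ (m - 1) * Real.exp (-p.2 ^ 2 / 2)) *
      G (p.1 ^ 2 / (p.1 ^ 2 + p.2 ^ 2))) with hF
  have hFm : Measurable F := by fun_prop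
  set A : ℝ → ℝ≥0∞ := fun ρ ↦ ENNReal.ofReal (ρ ^ (r + m - 1) * Real.exp (-ρ ^ 2 / 2)) with hA
  set B : ℝ → ℝ≥0∞ := fun θ ↦ ENNReal.ofReal (Real.cos θ ^ (r - 1) * Real.sin θ ^ (m - 1)) *
    G (Real.cos θ ^ 2) with hB
  have hQ : MeasurableSet (Set.Ioi (0 : ℝ) ×ˢ Set.Ioi (0 : ℝ)) :=
    measurableSet_Ioi.prod measurableSet_Ioi
  have hR : MeasurableSet (Set.Ioi (0 : ℝ) ×ˢ Set.Ioo (0 : ℝ) (Real.pi / 2)) :=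
    measurableSet_Ioi.prod measurableSet_Ioo
  have hpt : ∀ p ∈ polarCoord.target, ENNReal.ofReal p.1 •
      (Set.Ioi (0 : ℝ) ×ˢ Set.Ioi (0 : ℝ)).indicator F (polarCoord.symm p) =
      (Set.Ioi (0 : ℝ) ×ˢ Set.Ioo (0 : ℝ) (Real.pi / 2)).indicator (fun p ↦ A p.1 * B p.2) p := by
    rintro ⟨ρ, θ⟩ ⟨hρ, hθ⟩
    simp only [Set.mem_Ioi, Set.mem_Ioo] at hρ hθ
    rw [polarCoord_symm_apply]
    by_cases h : 0 < θ ∧ θ < Real.pi / 2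
    · have hc : 0 < Real.cos θ := Real.cos_pos_of_mem_Ioo ⟨by linarith, h.2⟩
      have hs : 0 < Real.sin θ := Real.sin_pos_of_pos_of_lt_pi h.1 (by linarith)
      rw [Set.indicator_of_mem (by simp [hρ, hc, hs]), Set.indicator_of_mem]
      · have h1 : (ρ * Real.cos θ) ^ 2 + (ρ * Real.sin θ) ^ 2 = ρ ^ 2 := by
          rw [mul_pow, mul_pow, ← mul_add, Real.cos_sq_add_sin_sq, mul_one]
        have h2 : (ρ * Real.cos θ) ^ 2 / ρ ^ 2 = Real.cos θ ^ 2 := by field_simp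
        simp only [hF, hA, hB, h1, h2, smul_eq_mul]
        rw [← mul_assoc, ← mul_assoc, ← mul_assoc, ← ENNReal.ofReal_mul (by positivity),
          ← ENNReal.ofReal_mul (by positivity), ← ENNReal.ofReal_mul (by positivity)]
        congr 2
        have h3 : Real.exp (-ρ ^ 2 / 2) = Real.exp (-(ρ * Real.cos θ) ^ 2 / 2) *
            Real.exp (-(ρ * Real.sin θ) ^ 2 / 2) := by
          rw [← Real.exp_add, ← h1]; ring_nf
        obtain ⟨r, rfl⟩ := Nat.exists_eq_add_of_le' hr
        obtain ⟨m, rfl⟩ := Nat.exists_eq_add_of_le' hm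
        rw [h3, show r + 1 + (m + 1) - 1 = r + m + 1 by omega]
        simp only [Nat.add_sub_cancel]
        ring
      · exact ⟨hρ, h⟩
    · rw [Set.indicator_of_notMem (a := (ρ * Real.cos θ, ρ * Real.sin θ)),
        Set.indicator_of_notMem, smul_zero]
      · exact fun h' ↦ h h'.2
      rintro ⟨h1, h2⟩
      have hc : 0 < Real.cos θ := (mul_pos_iff_of_pos_left hρ).1 h1
      have hs : 0 < Real.sin θ := (mul_pos_iff_of_pos_left hρ).1 h2
      refine h ⟨?_, ?_⟩
      · by_contra! h0
        exact hs.not_ge (Real.sin_nonpos_of_nonpos_of_neg_pi_le h0 hθ.1.le)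
      · by_contra! h0
        exact hc.not_ge (Real.cos_nonpos_of_pi_div_two_le_of_le h0 (by linarith))
  calc
    _ = ∫⁻ p in Set.Ioi (0 : ℝ) ×ˢ Set.Ioi (0 : ℝ), F p := by
      rw [Measure.volume_eq_prod, ← Measure.prod_restrict, lintegral_prod _ hFm.aemeasurable]
    _ = ∫⁻ p in polarCoord.target, ENNReal.ofReal p.1 •
        (Set.Ioi (0 : ℝ) ×ˢ Set.Ioi (0 : ℝ)).indicator F (polarCoord.symm p) := by
      rw [lintegral_comp_polarCoord_symm, lintegral_indicator hQ]
    _ = ∫⁻ p in Set.Ioi (0 : ℝ) ×ˢ Set.Ioo (0 : ℝ) (Real.pi / 2), A p.1 * B p.2 := by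
      rw [setLIntegral_congr_fun polarCoord.open_target.measurableSet hpt,
        setLIntegral_indicator hR, Set.inter_eq_left.2]
      exact Set.prod_mono subset_rfl
        (Set.Ioo_subset_Ioo (by linarith) (by linarith))
    _ = _ := by
      rw [Measure.volume_eq_prod, ← Measure.prod_restrict,
        lintegral_prod_mul (by fun_prop) (by fun_prop), ← lintegral_const_mul _ (by fun_prop)]

theorem lintegral_norm_sq_ratio_stdGaussian (E F : Type*)
    [NormedAddCommGroup E] [InnerProductSpace ℝ E] [FiniteDimensional ℝ E] [MeasurableSpace E]
    [BorelSpace E] [Nontrivial E]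
    [NormedAddCommGroup F] [InnerProductSpace ℝ F] [FiniteDimensional ℝ F] [MeasurableSpace F]
    [BorelSpace F] [Nontrivial F] :
    ∃ c : ℝ≥0∞, ∀ G : ℝ → ℝ≥0∞, Measurable G →
      ∫⁻ p, G (‖p.1‖ ^ 2 / (‖p.1‖ ^ 2 + ‖p.2‖ ^ 2)) ∂(stdGaussian E).prod (stdGaussian F) =
      c * ∫⁻ w in Set.Ioo (0 : ℝ) 1, ENNReal.ofReal
        (w ^ ((Module.finrank ℝ E : ℝ) / 2 - 1) * (1 - w) ^ ((Module.finrank ℝ F : ℝ) / 2 - 1)) *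
          G w := by
  obtain ⟨c₁, h₁⟩ := lintegral_fun_norm_stdGaussian E
  obtain ⟨c₂, h₂⟩ := lintegral_fun_norm_stdGaussian F
  obtain ⟨c₃, h₃⟩ := lintegral_gaussian_quadrant (Module.finrank_pos (R := ℝ) (M := E))
    (Module.finrank_pos (R := ℝ) (M := F))
  refine ⟨c₂ * (c₁ * c₃), fun G hG ↦ ?_⟩
  rw [lintegral_prod _ (by fun_prop)]
  have hy : ∀ x : E, ∫⁻ y, G (‖x‖ ^ 2 / (‖x‖ ^ 2 + ‖y‖ ^ 2)) ∂stdGaussian F =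
      c₂ * ∫⁻ t in Set.Ioi (0 : ℝ),
        ENNReal.ofReal (t ^ (Module.finrank ℝ F - 1) * Real.exp (-t ^ 2 / 2)) *
          G (‖x‖ ^ 2 / (‖x‖ ^ 2 + t ^ 2)) :=
    fun x ↦ h₂ (fun t ↦ G (‖x‖ ^ 2 / (‖x‖ ^ 2 + t ^ 2))) (by fun_prop)
  simp only [hy]
  have hm : Measurable fun s : ℝ ↦ ∫⁻ t in Set.Ioi (0 : ℝ),
      ENNReal.ofReal (t ^ (Module.finrank ℝ F - 1) * Real.exp (-t ^ 2 / 2)) *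
        G (s ^ 2 / (s ^ 2 + t ^ 2)) := by
    apply Measurable.lintegral_prod_right
    fun_prop
  rw [h₁ (fun s ↦ c₂ * ∫⁻ t in Set.Ioi (0 : ℝ),
      ENNReal.ofReal (t ^ (Module.finrank ℝ F - 1) * Real.exp (-t ^ 2 / 2)) *
        G (s ^ 2 / (s ^ 2 + t ^ 2))) (by fun_prop)]
  simp only [mul_left_comm (ENNReal.ofReal _) c₂]
  rw [lintegral_const_mul _ (by fun_prop), mul_left_comm c₁ c₂, mul_assoc c₂, mul_assoc c₁,
    ← h₃ G hG]
  congr 3 with s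
  rw [← lintegral_const_mul _ (by fun_prop)]

theorem measure_norm_sq_lt_stdGaussian_prod (E F : Type*)
    [NormedAddCommGroup E] [InnerProductSpace ℝ E] [FiniteDimensional ℝ E] [MeasurableSpace E]
    [BorelSpace E] [Nontrivial E]
    [NormedAddCommGroup F] [InnerProductSpace ℝ F] [FiniteDimensional ℝ F] [MeasurableSpace F]
    [BorelSpace F] [Nontrivial F] {α : ℝ} (hα : α ∈ Set.Ioo (0 : ℝ) 1) :
    (stdGaussian E).prod (stdGaussian F) {p | α * (‖p.1‖ ^ 2 + ‖p.2‖ ^ 2) < ‖p.1‖ ^ 2} =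
      ENNReal.ofReal
        (1 - regIncBeta (Module.finrank ℝ E / 2) (Module.finrank ℝ F / 2) α) := by
  obtain ⟨c, hc⟩ := lintegral_norm_sq_ratio_stdGaussian E F
  set a : ℝ := Module.finrank ℝ E / 2
  set b : ℝ := Module.finrank ℝ F / 2
  set β : ℝ → ℝ := fun w ↦ w ^ (a - 1) * (1 - w) ^ (b - 1) with hβ
  have hβ0 : ∀ w ∈ Set.Ioo (0 : ℝ) 1, 0 ≤ β w := fun w hw ↦
    mul_nonneg (Real.rpow_nonneg hw.1.le _) (Real.rpow_nonneg (by linarith [hw.2]) _)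
  have hβm : Measurable β := by fun_prop
  have hone : c * ∫⁻ w in Set.Ioo (0 : ℝ) 1, ENNReal.ofReal (β w) = 1 := by
    simpa using (hc (fun _ ↦ 1) measurable_const).symm
  have hJtop : ∫⁻ w in Set.Ioo (0 : ℝ) 1, ENNReal.ofReal (β w) ≠ ⊤ := by
    intro h
    rw [h] at hone
    rcases eq_or_ne c 0 with rfl | h0
    · simp at hone
    · simp [ENNReal.mul_top h0] at hone
  have hint : IntegrableOn β (Set.Ioo 0 1) :=
    (lintegral_ofReal_ne_top_iff_integrable hβm.aestronglyMeasurable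
      (ae_restrict_of_forall_mem measurableSet_Ioo hβ0)).1 hJtop
  have hsub : Set.Ioo α 1 ⊆ Set.Ioo 0 1 := Set.Ioo_subset_Ioo_left hα.1.le
  have hset : {p : E × F | α * (‖p.1‖ ^ 2 + ‖p.2‖ ^ 2) < ‖p.1‖ ^ 2} =
      {p | ‖p.1‖ ^ 2 / (‖p.1‖ ^ 2 + ‖p.2‖ ^ 2) ∈ Set.Ioi α} := by
    ext p
    simp only [Set.mem_ofPred_eq, Set.mem_Ioi]
    rcases (by positivity : 0 ≤ ‖p.1‖ ^ 2 + ‖p.2‖ ^ 2).eq_or_lt with h | h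
    · have : ‖p.1‖ ^ 2 = 0 := by nlinarith [sq_nonneg ‖p.1‖, sq_nonneg ‖p.2‖]
      rw [← h, this]
      simp [hα.1.le]
    · rw [lt_div_iff₀ h]
  have hq : (stdGaussian E).prod (stdGaussian F)
      {p | α * (‖p.1‖ ^ 2 + ‖p.2‖ ^ 2) < ‖p.1‖ ^ 2} =
      c * ∫⁻ w in Set.Ioo α 1, ENNReal.ofReal (β w) := by
    have hm : MeasurableSet {p : E × F | ‖p.1‖ ^ 2 / (‖p.1‖ ^ 2 + ‖p.2‖ ^ 2) ∈ Set.Ioi α} :=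
      measurableSet_Ioi.preimage (by fun_prop)
    rw [hset, ← lintegral_indicator_one hm]
    have := hc ((Set.Ioi α).indicator 1) (measurable_one.indicator measurableSet_Ioi)
    refine (lintegral_congr fun p ↦ ?_).trans (this.trans ?_)
    · rfl
    · congr 1
      have : ∀ w, ENNReal.ofReal (w ^ (a - 1) * (1 - w) ^ (b - 1)) *
          (Set.Ioi α).indicator 1 w = (Set.Ioi α).indicator (fun w ↦ ENNReal.ofReal (β w)) w := by
        intro w
        by_cases h : w ∈ Set.Ioi α <;> simp [h, hβ]
      simp only [this]
      rw [setLIntegral_indicator measurableSet_Ioi, Set.inter_comm, Set.Ioo_inter_Ioi,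
        max_eq_right hα.1.le]
  have hII : ∀ u v : ℝ, 0 ≤ u → v ≤ 1 → u ≤ v → IntervalIntegrable β volume u v := by
    intro u v hu hv huv
    rw [intervalIntegrable_iff_integrableOn_Ioo_of_le huv]
    exact hint.mono_set (Set.Ioo_subset_Ioo hu hv)
  have hB : ∫⁻ w in Set.Ioo (0 : ℝ) 1, ENNReal.ofReal (β w) =
      ENNReal.ofReal (∫ t in (0 : ℝ)..1, β t) := by
    rw [intervalIntegral.integral_of_le zero_le_one, integral_Ioc_eq_integral_Ioo,
      ofReal_integral_eq_lintegral_ofReal hint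
        (ae_restrict_of_forall_mem measurableSet_Ioo hβ0)]
  have hBα : ∫⁻ w in Set.Ioo α 1, ENNReal.ofReal (β w) =
      ENNReal.ofReal (∫ t in α..1, β t) := by
    rw [intervalIntegral.integral_of_le hα.2.le, integral_Ioc_eq_integral_Ioo,
      ofReal_integral_eq_lintegral_ofReal (hint.mono_set hsub)
        (ae_restrict_of_forall_mem measurableSet_Ioo fun w hw ↦ hβ0 w (hsub hw))]
  have hBpos : 0 < ∫ t in (0 : ℝ)..1, β t := by
    rw [← ENNReal.ofReal_pos, ← hB, pos_iff_ne_zero]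
    intro h
    simp [h] at hone
  have hadd : (∫ t in (0 : ℝ)..α, β t) + ∫ t in α..1, β t = ∫ t in (0 : ℝ)..1, β t :=
    intervalIntegral.integral_add_adjacent_intervals (hII 0 α le_rfl hα.2.le hα.1.le)
      (hII α 1 hα.1.le le_rfl hα.2.le)
  rw [hq, ENNReal.eq_inv_of_mul_eq_one_left hone, hB, hBα, ← ENNReal.ofReal_inv_of_pos hBpos,
    ← ENNReal.ofReal_mul (by positivity)]
  congr 1
  rw [regIncBeta, ← hadd]
  rw [← hadd] at hBpos
  field_simp
  ring

theorem ae_ne_zero_stdGaussian (E : Type*) [NormedAddCommGroup E] [InnerProductSpace ℝ E]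
    [FiniteDimensional ℝ E] [MeasurableSpace E] [BorelSpace E] [Nontrivial E] :
    ∀ᵐ g ∂stdGaussian E, g ≠ 0 := by
  obtain ⟨c, hc⟩ := stdGaussian_eq_withDensity E
  rw [hc]
  have hac : c • (volume : Measure E).withDensity
      (fun x ↦ ENNReal.ofReal (Real.exp (-‖x‖ ^ 2 / 2))) ≪ volume :=
    (withDensity_absolutelyContinuous _ _).smul_left c
  exact hac.ae_le (Measure.ae_ne volume 0)

theorem measurePreserving_flip_pi_pi {ι κ X : Type*} [Fintype ι] [Fintype κ] [MeasurableSpace X]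
    (μ : Measure X) [IsProbabilityMeasure μ] :
    MeasurePreserving (fun (z : ι → κ → X) j i ↦ z i j)
      (Measure.pi fun _ ↦ Measure.pi fun _ ↦ μ) (Measure.pi fun _ ↦ Measure.pi fun _ ↦ μ) := by
  refine ⟨by fun_prop, ?_⟩
  have h₁ := Measure.infinitePi_map_curry (ι := ι) (κ := κ) fun _ _ ↦ μ
  have h₂ := Measure.infinitePi_map_curry (ι := κ) (κ := ι) fun _ _ ↦ μ
  have h₃ := (measurePreserving_piCongrLeft (fun _ ↦ μ) (Equiv.prodComm ι κ)).map_eq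
  simp only [Measure.infinitePi_eq_pi] at h₁ h₂
  rw [← h₁, ← h₂, ← h₃, Measure.map_map (by fun_prop) (by fun_prop),
    Measure.map_map (by fun_prop) (by fun_prop)]
  congr 1

theorem measure_sum_sq_lt_pi_gaussianReal {r m : ℕ} (hr : 1 ≤ r) (hm : 1 ≤ m) {α : ℝ}
    (hα : α ∈ Set.Ioo (0 : ℝ) 1) :
    Measure.pi (fun _ : Fin r ⊕ Fin m ↦ gaussianReal 0 1)
      {x | α * ∑ i, x i ^ 2 < ∑ i, x (Sum.inl i) ^ 2} =
      ENNReal.ofReal (1 - regIncBeta (r / 2) (m / 2) α) := by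
  have : Nonempty (Fin r) := ⟨⟨0, hr⟩⟩
  have : Nonempty (Fin m) := ⟨⟨0, hm⟩⟩
  have h := measure_norm_sq_lt_stdGaussian_prod (EuclideanSpace ℝ (Fin r))
    (EuclideanSpace ℝ (Fin m)) hα
  rw [finrank_euclideanSpace_fin, finrank_euclideanSpace_fin, ← map_pi_eq_stdGaussian,
    ← map_pi_eq_stdGaussian, Measure.map_prod_map _ _ (by fun_prop) (by fun_prop),
    ← (measurePreserving_sumPiEquivProdPi
      (fun _ : Fin r ⊕ Fin m ↦ gaussianReal 0 1)).map_eq,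
    Measure.map_map (by fun_prop) (by fun_prop), Measure.map_apply (by fun_prop)
      (measurableSet_lt (by fun_prop) (by fun_prop))] at h
  rw [← h]
  congr 1
  ext x
  simp [EuclideanSpace.real_norm_sq_eq, MeasurableEquiv.sumPiEquivProdPi,
    Equiv.sumPiEquivProdPi]

/-- The pairs `(W, g)` such that the orthogonal projection of `g` onto the span of the vectors
`W j` has squared norm larger than `α * ‖g‖ ^ 2`, as `‖P g‖ ^ 2` is the maximum of
`2 * ⟪g, w⟫ - ‖w‖ ^ 2` over `w` in the span. -/
def largeProjection (E : Type*) [NormedAddCommGroup E] [InnerProductSpace ℝ E] (r : ℕ) (α : ℝ) :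
    Set ((Fin r → E) × E) :=
  {p | ∃ x : Fin r → ℝ,
    α * ‖p.2‖ ^ 2 < 2 * inner ℝ p.2 (∑ j, x j • p.1 j) - ‖∑ j, x j • p.1 j‖ ^ 2}

section LargeProjection

variable {E : Type*} [NormedAddCommGroup E] [InnerProductSpace ℝ E] {r : ℕ} {α : ℝ}

theorem isOpen_largeProjection : IsOpen (largeProjection E r α) := by
  have : largeProjection E r α = ⋃ x : Fin r → ℝ, {p | α * ‖p.2‖ ^ 2 <
      2 * inner ℝ p.2 (∑ j, x j • p.1 j) - ‖∑ j, x j • p.1 j‖ ^ 2} := by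
    ext p; simp [largeProjection]
  rw [this]
  exact isOpen_iUnion fun x ↦ isOpen_lt (by fun_prop) (by fun_prop)

theorem map_mem_largeProjection (L : E ≃ₗᵢ[ℝ] E) (W : Fin r → E) (g : E) :
    ((fun j ↦ L (W j)), L g) ∈ largeProjection E r α ↔ (W, g) ∈ largeProjection E r α := by
  simp only [largeProjection, Set.mem_ofPred_eq, ← map_smul, ← map_sum, L.norm_map,
    L.inner_map_map]

theorem smul_mem_largeProjection {W : Fin r → E} {g : E} {c : ℝ} (hc : c ≠ 0)
    (h : (W, g) ∈ largeProjection E r α) : (W, c • g) ∈ largeProjection E r α := by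
  obtain ⟨x, hx⟩ := h
  refine ⟨c • x, ?_⟩
  have : ∑ j, (c • x) j • W j = c • ∑ j, x j • W j := by
    simp [Finset.smul_sum, smul_smul]
  simp only [this, norm_smul, mul_pow, real_inner_smul_left, real_inner_smul_right,
    Real.norm_eq_abs, sq_abs] at hx ⊢
  have := mul_lt_mul_of_pos_left hx (by positivity : 0 < c ^ 2)
  linarith

theorem smul_mem_largeProjection_iff {W : Fin r → E} {g : E} {c : ℝ} (hc : c ≠ 0) :
    (W, c • g) ∈ largeProjection E r α ↔ (W, g) ∈ largeProjection E r α := by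
  refine ⟨fun h ↦ ?_, smul_mem_largeProjection hc⟩
  simpa [smul_smul, hc] using smul_mem_largeProjection (inv_ne_zero hc) h

theorem exists_orthonormalBasis_inner_inr_eq_zero [FiniteDimensional ℝ E] {m : ℕ}
    (hE : Module.finrank ℝ E = r + m)
    (W : Fin r → E) :
    ∃ b : OrthonormalBasis (Fin r ⊕ Fin m) ℝ E, ∀ i j, inner ℝ (b (Sum.inr i)) (W j) = 0 := by
  set U := Submodule.span ℝ (Set.range W)
  have hk : Module.finrank ℝ U ≤ r := by
    simpa [Set.finrank] using finrank_range_le_card (R := ℝ) W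
  set e : Fin r ⊕ Fin m → E := fun i ↦ Sum.elim
    (fun i : Fin r ↦ if h : i.1 < Module.finrank ℝ U then
      (stdOrthonormalBasis ℝ U ⟨i, h⟩ : E) else 0)
    (fun _ ↦ 0) i
  set s : Set (Fin r ⊕ Fin m) := Set.range fun k : Fin (Module.finrank ℝ U) ↦
    Sum.inl (Fin.castLE hk k)
  have he : ∀ k, e (Sum.inl (Fin.castLE hk k)) = stdOrthonormalBasis ℝ U k := by
    intro k; simp [e]
  have hs : Orthonormal ℝ (s.domRestrict e) := by
    rw [orthonormal_iff_ite]
    rintro ⟨_, k, rfl⟩ ⟨_, l, rfl⟩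
    simp only [Set.domRestrict_apply, he, ← Submodule.coe_inner]
    rw [orthonormal_iff_ite.1 (stdOrthonormalBasis ℝ U).orthonormal]
    exact if_congr (by simp [Subtype.ext_iff]) rfl rfl
  obtain ⟨b, hb⟩ := hs.exists_orthonormalBasis_extension_of_card_eq (by simp [hE])
  refine ⟨b, fun i j ↦ ?_⟩
  have hW : W j ∈ U := Submodule.subset_span ⟨j, rfl⟩
  have := congrArg (Subtype.val) ((stdOrthonormalBasis ℝ U).sum_repr ⟨W j, hW⟩)
  simp only at this
  rw [← this, AddSubmonoidClass.coe_finsetSum, inner_sum]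
  refine Finset.sum_eq_zero fun k _ ↦ ?_
  rw [Submodule.coe_smul, ← he, ← hb _ ⟨k, rfl⟩, inner_smul_right,
    b.orthonormal.2 (by simp), mul_zero]

variable [MeasurableSpace E] [BorelSpace E]

theorem measurableSet_largeProjection_right (W : Fin r → E) :
    MeasurableSet {g | (W, g) ∈ largeProjection E r α} :=
  (isOpen_largeProjection.preimage (by fun_prop : Continuous fun g : E ↦ (W, g))).measurableSet

variable [FiniteDimensional ℝ E]

theorem measurableSet_largeProjection_left (g : E) :
    MeasurableSet {W | (W, g) ∈ largeProjection E r α} :=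
  (isOpen_largeProjection.preimage
    (by fun_prop : Continuous fun W : Fin r → E ↦ (W, g))).measurableSet

theorem stdGaussian_largeProjection_le {m : ℕ} (hr : 1 ≤ r) (hm : 1 ≤ m)
    (hE : Module.finrank ℝ E = r + m) (hα : α ∈ Set.Ioo (0 : ℝ) 1) (W : Fin r → E) :
    stdGaussian E {g | (W, g) ∈ largeProjection E r α} ≤
      ENNReal.ofReal (1 - regIncBeta (r / 2) (m / 2) α) := by
  obtain ⟨b, hb⟩ := exists_orthonormalBasis_inner_inr_eq_zero hE W
  rw [stdGaussian_eq_map_pi_orthonormalBasis b, Measure.map_apply (by fun_prop)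
    (measurableSet_largeProjection_right W),
    ← measure_sum_sq_lt_pi_gaussianReal hr hm hα]
  refine measure_mono ?_
  rintro y ⟨x, hx⟩
  set w := ∑ j, x j • W j
  have hw : ∀ i, inner ℝ (b (Sum.inr i)) w = 0 := by
    intro i
    rw [inner_sum]
    exact Finset.sum_eq_zero fun j _ ↦ by rw [inner_smul_right, hb, mul_zero]
  have hg : ∀ i, inner ℝ (b i) (∑ i, y i • b i) = y i := fun i ↦
    b.orthonormal.inner_right_fintype y i
  have hinner : inner ℝ (∑ i, y i • b i) w = ∑ i, y (Sum.inl i) * inner ℝ (b (Sum.inl i)) w := by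
    rw [sum_inner]
    simp [real_inner_smul_left, hw]
  have hnw : ‖w‖ ^ 2 = ∑ i, inner ℝ (b (Sum.inl i)) w ^ 2 := by
    rw [← b.sum_sq_inner_right]
    simp [hw]
  have hng : ‖∑ i, y i • b i‖ ^ 2 = ∑ i, y i ^ 2 := by
    rw [← b.sum_sq_inner_right]
    exact Finset.sum_congr rfl fun i _ ↦ by rw [hg]
  simp only [hinner, hnw, hng] at hx
  refine hx.trans_le ?_
  rw [Finset.mul_sum, ← Finset.sum_sub_distrib]
  exact Finset.sum_le_sum fun i _ ↦ by
    nlinarith [sq_nonneg (y (Sum.inl i) - inner ℝ (b (Sum.inl i)) w)]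

theorem pi_stdGaussian_largeProjection_eq {u v : E} (hu : u ≠ 0) (hv : v ≠ 0) :
    Measure.pi (fun _ : Fin r ↦ stdGaussian E) {W | (W, u) ∈ largeProjection E r α} =
      Measure.pi (fun _ : Fin r ↦ stdGaussian E) {W | (W, v) ∈ largeProjection E r α} := by
  have hu' : ‖u‖ ≠ 0 := norm_ne_zero_iff.2 hu
  have hv' : ‖v‖ ≠ 0 := norm_ne_zero_iff.2 hv
  set c := ‖v‖ / ‖u‖
  have hc : c ≠ 0 := div_ne_zero hv' hu'
  have hnorm : ‖c • u‖ = ‖v‖ := by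
    rw [norm_smul, Real.norm_of_nonneg (by positivity), div_mul_cancel₀ _ hu']
  set L : E ≃ₗᵢ[ℝ] E := (ℝ ∙ (c • u - v))ᗮ.reflection
  have hL : L (c • u) = v := Submodule.reflection_sub hnorm
  have hpres : MeasurePreserving (fun (W : Fin r → E) j ↦ L (W j))
      (Measure.pi fun _ : Fin r ↦ stdGaussian E) (Measure.pi fun _ : Fin r ↦ stdGaussian E) :=
    measurePreserving_pi _ _ fun _ ↦ ⟨by fun_prop, stdGaussian_map L⟩
  rw [← hpres.measure_preimage (measurableSet_largeProjection_left v).nullMeasurableSet]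
  congr 1
  ext W
  simp only [Set.mem_ofPred_eq, Set.mem_preimage]
  have h := map_mem_largeProjection (α := α) L W (c • u)
  rw [hL] at h
  rw [h, smul_mem_largeProjection_iff hc]

theorem pi_stdGaussian_largeProjection_le {m : ℕ} (hr : 1 ≤ r) (hm : 1 ≤ m)
    (hE : Module.finrank ℝ E = r + m) (hα : α ∈ Set.Ioo (0 : ℝ) 1) {u : E} (hu : u ≠ 0) :
    Measure.pi (fun _ : Fin r ↦ stdGaussian E) {W | (W, u) ∈ largeProjection E r α} ≤
      ENNReal.ofReal (1 - regIncBeta (r / 2) (m / 2) α) := by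
  have hS : MeasurableSet (largeProjection E r α) := isOpen_largeProjection.measurableSet
  set μ := Measure.pi fun _ : Fin r ↦ stdGaussian E
  have : Nontrivial E := Module.nontrivial_of_finrank_pos (R := ℝ) (by omega)
  calc μ {W | (W, u) ∈ largeProjection E r α}
    _ = ∫⁻ g, μ {W | (W, g) ∈ largeProjection E r α} ∂stdGaussian E := by
      rw [lintegral_congr_ae ((ae_ne_zero_stdGaussian E).mono fun g hg ↦
        pi_stdGaussian_largeProjection_eq hg hu)]
      simp [μ]
    _ = (μ.prod (stdGaussian E)) (largeProjection E r α) :=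
      (Measure.prod_apply_symm hS).symm
    _ = ∫⁻ W, stdGaussian E {g | (W, g) ∈ largeProjection E r α} ∂μ := Measure.prod_apply hS
    _ ≤ ∫⁻ _, ENNReal.ofReal (1 - regIncBeta (r / 2) (m / 2) α) ∂μ :=
      lintegral_mono fun W ↦ stdGaussian_largeProjection_le hr hm hE hα W
    _ = _ := by simp

end LargeProjection

theorem map_columns_eq_pi_stdGaussian (d r : ℕ) :
    Measure.map (fun (z : Fin d → Fin r → ℝ) j ↦ WithLp.toLp 2 fun i ↦ z i j)
      (Measure.pi fun _ ↦ Measure.pi fun _ ↦ gaussianReal 0 1) =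
      Measure.pi fun _ ↦ stdGaussian (EuclideanSpace ℝ (Fin d)) := by
  have h := measurePreserving_pi (fun _ : Fin r ↦ Measure.pi fun _ : Fin d ↦ gaussianReal 0 1)
    (fun _ ↦ stdGaussian (EuclideanSpace ℝ (Fin d)))
    (f := fun _ ↦ WithLp.toLp 2) fun _ ↦ ⟨by fun_prop, map_pi_eq_stdGaussian⟩
  exact (h.comp (measurePreserving_flip_pi_pi (gaussianReal 0 1))).map_eq

theorem Matrix.trace_eq_sum_inner_orthonormalBasis {d : ℕ} {ι : Type*} [Fintype ι]
    (b : OrthonormalBasis ι ℝ (EuclideanSpace ℝ (Fin d))) (M : Matrix (Fin d) (Fin d) ℝ) :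
    M.trace = ∑ i, inner ℝ (b i) (toEuclideanLin M (b i)) := by
  rw [← LinearMap.trace_eq_sum_inner, toEuclideanLin_eq_toLin_orthonormal, Matrix.trace_toLin_eq]

theorem Matrix.sum_sq_eq_trace {m n : Type*} [Fintype m] [Fintype n] (M : Matrix m n ℝ) :
    ∑ i, ∑ k, M i k ^ 2 = (M * Mᵀ).trace := by
  simp [Matrix.trace, Matrix.mul_apply, sq]

theorem inner_toEuclideanLin_eq_norm_sq {d : ℕ} {P : Matrix (Fin d) (Fin d) ℝ} (hs : Pᵀ = P)
    (hi : P * P = P) (u : EuclideanSpace ℝ (Fin d)) :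
    inner ℝ u (toEuclideanLin P u) = ‖toEuclideanLin P u‖ ^ 2 := by
  rw [← real_inner_self_eq_norm_sq]
  nth_rewrite 1 [← hi]
  simp only [EuclideanSpace.inner_eq_star_dotProduct, star_trivial, ofLp_toLpLin, toLin'_apply]
  rw [← Matrix.mulVec_mulVec, Matrix.mulVec_mulVec, ← Matrix.mulVec_mulVec,
    ← Matrix.vecMul_transpose, ← Matrix.dotProduct_mulVec, hs]

theorem exists_eigenvalue_lt_inner {d n : ℕ} {P : Matrix (Fin d) (Fin d) ℝ} (hs : Pᵀ = P)
    (hi : P * P = P) (V : Matrix (Fin d) (Fin n) ℝ) (hV : (V * Vᵀ).IsHermitian) {α : ℝ}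
    (h : α * ∑ i, ∑ k, V i k ^ 2 < ∑ i, ∑ k, (P * V) i k ^ 2) :
    ∃ i, hV.eigenvalues i ≠ 0 ∧
      α < inner ℝ (hV.eigenvectorBasis i) (toEuclideanLin P (hV.eigenvectorBasis i)) := by
  have hpos : (V * Vᵀ).PosSemidef := by
    simpa using Matrix.posSemidef_self_mul_conjTranspose V
  have h₁ : ∑ i, ∑ k, V i k ^ 2 = ∑ i, hV.eigenvalues i := by
    rw [Matrix.sum_sq_eq_trace, hV.trace_eq_sum_eigenvalues]
    simp
  have h₂ : ∑ i, ∑ k, (P * V) i k ^ 2 = ∑ i, hV.eigenvalues i *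
      inner ℝ (hV.eigenvectorBasis i) (toEuclideanLin P (hV.eigenvectorBasis i)) := by
    rw [Matrix.sum_sq_eq_trace, Matrix.transpose_mul, hs, Matrix.mul_assoc, Matrix.trace_mul_comm,
      Matrix.mul_assoc, Matrix.mul_assoc, hi, ← Matrix.mul_assoc, Matrix.trace_mul_comm,
      Matrix.trace_eq_sum_inner_orthonormalBasis hV.eigenvectorBasis]
    refine Finset.sum_congr rfl fun i _ ↦ ?_
    have : toEuclideanLin (P * (V * Vᵀ)) (hV.eigenvectorBasis i) =
        hV.eigenvalues i • toEuclideanLin P (hV.eigenvectorBasis i) := by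
      ext1
      simp only [WithLp.ofLp_smul, ofLp_toLpLin, toLin'_apply]
      rw [← Matrix.mulVec_mulVec, hV.mulVec_eigenvectorBasis, Matrix.mulVec_smul]
    rw [this, inner_smul_right]
  rw [h₁, h₂, Finset.mul_sum] at h
  obtain ⟨i, -, hlt⟩ := Finset.exists_lt_of_sum_lt h
  have h0 : hV.eigenvalues i ≠ 0 := by
    rintro h0
    simp [h0] at hlt
  refine ⟨i, h0, ?_⟩
  rw [mul_comm α] at hlt
  exact lt_of_mul_lt_mul_left hlt (hpos.eigenvalues_nonneg i)

theorem mem_largeProjection_of_lt_inner {d r : ℕ} {P : Matrix (Fin d) (Fin d) ℝ} (hs : Pᵀ = P)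
    (hi : P * P = P) {z : Fin d → Fin r → ℝ}
    (hrange : LinearMap.range (Matrix.toLin' P) = LinearMap.range (Matrix.toLin' (Matrix.of z)))
    {u : EuclideanSpace ℝ (Fin d)} (hu : ‖u‖ = 1) {α : ℝ}
    (h : α < inner ℝ u (toEuclideanLin P u)) :
    ((fun j ↦ WithLp.toLp 2 fun i ↦ z i j), u) ∈
      largeProjection (EuclideanSpace ℝ (Fin d)) r α := by
  have hmem : Matrix.toLin' P u.ofLp ∈ LinearMap.range (Matrix.toLin' (Matrix.of z)) :=
    hrange ▸ LinearMap.mem_range_self _ _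
  obtain ⟨x, hx⟩ := hmem
  refine ⟨x, ?_⟩
  have hsum : ∑ j, x j • (WithLp.toLp 2 fun i ↦ z i j) = toEuclideanLin P u := by
    ext i
    have := congrFun hx i
    simp only [Matrix.toLin'_apply] at this
    rw [ofLp_toLpLin, toLin'_apply, ← this]
    simp [Matrix.mulVec, dotProduct, mul_comm]
  simp only [hsum, ← inner_toEuclideanLin_eq_norm_sq hs hi, hu]
  linarith

/-- tail bound for the Haar projection.  If `P_M` is the orthogonal
projector onto the column space of a `d × r` i.i.d. standard Gaussian matrix `Z`
(`1 ≤ r ≤ d − 1`) and `ΔV ≠ 0` has rank `s`, then for every `α ∈ (0,1)`,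
`ℙ(‖P_M ΔV‖_F² > α ‖ΔV‖_F²) ≤ s (1 − I_α(r/2, (d−r)/2))`. -/
theorem stmt14
    {Ω : Type} [MeasureSpace Ω] [IsProbabilityMeasure (ℙ : Measure Ω)]
    (d r n s : ℕ) (hr : 1 ≤ r) (hrd : r ≤ d - 1) (hd : 1 ≤ d)
    (Z : Ω → Fin d → Fin r → ℝ)
    (hZ : Measure.map Z ℙ
      = Measure.pi fun _ : Fin d => Measure.pi fun _ : Fin r => gaussianReal 0 1)
    (Pm : Ω → Matrix (Fin d) (Fin d) ℝ)
    (hPmsymm : ∀ ω, (Pm ω)ᵀ = Pm ω) (hPmidem : ∀ ω, Pm ω * Pm ω = Pm ω)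
    (hPmrange : ∀ ω, LinearMap.range (Matrix.toLin' (Pm ω))
      = LinearMap.range (Matrix.toLin' (Matrix.of (Z ω))))
    (ΔV : Matrix (Fin d) (Fin n) ℝ) (hΔV : ΔV ≠ 0)
    (hs : ΔV.rank = s) (hs1 : 1 ≤ s)
    (α : ℝ) (hα : α ∈ Set.Ioo (0 : ℝ) 1) :
    ℙ {ω | α * ∑ i, ∑ k, (ΔV i k) ^ 2 < ∑ i, ∑ k, ((Pm ω * ΔV) i k) ^ 2}
      ≤ ENNReal.ofReal (s * (1 - regIncBeta (r / 2) ((d - r) / 2) α)) := by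
  have hV : (ΔV * ΔVᵀ).IsHermitian := by
    simpa using Matrix.isHermitian_mul_conjTranspose_self ΔV
  have hcard : #{i | hV.eigenvalues i ≠ 0} = s := by
    rw [← hs, ← Matrix.rank_self_mul_transpose, hV.rank_eq_card_non_zero_eigs,
      Fintype.card_subtype]
  have hZm : AEMeasurable Z ℙ := by
    refine AEMeasurable.of_map_ne_zero ?_
    rw [hZ]
    exact IsProbabilityMeasure.ne_zero _
  set cols : (Fin d → Fin r → ℝ) → Fin r → EuclideanSpace ℝ (Fin d) :=
    fun z j ↦ WithLp.toLp 2 fun i ↦ z i j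
  have hcols : Measurable cols := by fun_prop
  set q := ENNReal.ofReal (1 - regIncBeta (r / 2) ((d - r) / 2) α)
  have hq : ∀ i, ℙ {ω | (cols (Z ω), hV.eigenvectorBasis i) ∈
      largeProjection (EuclideanSpace ℝ (Fin d)) r α} ≤ q := by
    intro i
    have := pi_stdGaussian_largeProjection_le (E := EuclideanSpace ℝ (Fin d)) (m := d - r) hr
      (by omega) (by rw [finrank_euclideanSpace_fin]; omega) hα
      (hV.eigenvectorBasis.orthonormal.ne_zero i)
    rwa [← map_columns_eq_pi_stdGaussian, ← hZ, AEMeasurable.map_map_of_aemeasurable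
      hcols.aemeasurable hZm, Measure.map_apply_of_aemeasurable (hcols.comp_aemeasurable hZm)
      (measurableSet_largeProjection_left _), Nat.cast_sub (by omega)] at this
  calc ℙ {ω | α * ∑ i, ∑ k, (ΔV i k) ^ 2 < ∑ i, ∑ k, ((Pm ω * ΔV) i k) ^ 2}
    _ ≤ ℙ (⋃ i ∈ ({i | hV.eigenvalues i ≠ 0} : Finset (Fin d)),
        {ω | (cols (Z ω), hV.eigenvectorBasis i) ∈
          largeProjection (EuclideanSpace ℝ (Fin d)) r α}) := by
      refine measure_mono fun ω hω ↦ ?_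
      obtain ⟨i, h0, hlt⟩ := exists_eigenvalue_lt_inner (hPmsymm ω) (hPmidem ω) ΔV hV hω
      refine Set.mem_biUnion (x := i) (by simpa using h0) ?_
      exact mem_largeProjection_of_lt_inner (hPmsymm ω) (hPmidem ω) (hPmrange ω)
        (hV.eigenvectorBasis.orthonormal.1 i) hlt
    _ ≤ ∑ i with hV.eigenvalues i ≠ 0, ℙ {ω | (cols (Z ω), hV.eigenvectorBasis i) ∈
          largeProjection (EuclideanSpace ℝ (Fin d)) r α} := measure_biUnion_finset_le _ _
    _ ≤ #{i | hV.eigenvalues i ≠ 0} • q := Finset.sum_le_card_nsmul _ _ _ fun i _ ↦ hq i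
    _ = ENNReal.ofReal (s * (1 - regIncBeta (r / 2) ((d - r) / 2) α)) := by
      rw [hcard, nsmul_eq_mul, ENNReal.ofReal_mul (by positivity), ENNReal.ofReal_natCast]
end
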